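/- arXiv:2211.06067 — 2 statements merged into one kernel-verified Lean document; each statement's English description precedes it below -/
import Mathlib

section
/- There exists a C^∞ μ-preserving diffeomorphism T of the torus T² such that the Lebesgue measure μ is a generic measure for T but T is not ergodic with respect to μ; in other words, there exists a smooth area-preserving torus diffeomorphism admitting a non-ergodic generic measure. -/
open MeasureTheory Filter Topology
open scoped ENNReal
noncomputable section

abbrev Torus2 := UnitAddCircle × UnitAddCircle

/-- Canonical projection `ℝ² → 𝕋²`. -/
def torusProj : ℝ × ℝ → Torus2 := fun p => ((p.1 : UnitAddCircle), (p.2 : UnitAddCircle))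

/-- `F : ℝ² → ℝ²` is a lift of `f : 𝕋² → 𝕋²`. -/
def IsLift (F : ℝ × ℝ → ℝ × ℝ) (f : Torus2 → Torus2) : Prop :=
  ∀ p : ℝ × ℝ, torusProj (F p) = f (torusProj p)

/-- `F` commutes with integer translations. -/
def IntEquivariant (F : ℝ × ℝ → ℝ × ℝ) : Prop :=
  ∀ p : ℝ × ℝ, ∀ m : ℤ × ℤ, F (p + ((m.1 : ℝ), (m.2 : ℝ))) = F p + ((m.1 : ℝ), (m.2 : ℝ))

/-- A C^∞ measure-preserving diffeomorphism of the torus 𝕋². -/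
structure SmoothMPTorusDiffeo where
  toEquiv : Torus2 ≃ Torus2
  lift : ℝ × ℝ → ℝ × ℝ
  liftInv : ℝ × ℝ → ℝ × ℝ
  lift_contDiff : ContDiff ℝ (⊤ : ℕ∞) lift
  liftInv_contDiff : ContDiff ℝ (⊤ : ℕ∞) liftInv
  lift_equivariant : IntEquivariant lift
  liftInv_equivariant : IntEquivariant liftInv
  lift_isLift : IsLift lift toEquiv
  liftInv_isLift : IsLift liftInv toEquiv.symm
  measurePreserving : MeasurePreserving toEquiv volume volume

/-- generic point -/
def IsGenericPt (T : Torus2 → Torus2) (ν : Measure Torus2) (x : Torus2) : Prop :=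
  ∀ f : C(Torus2, ℝ),
    Tendsto (fun N : ℕ => (N : ℝ)⁻¹ * ∑ i ∈ Finset.range N, f (T^[i] x)) atTop
      (𝓝 (∫ y, f y ∂ν))

def IsMinimalMap (T : Torus2 → Torus2) : Prop :=
  ∀ x : Torus2, Dense (Set.range fun n : ℕ => T^[n] x)

def IsWeakMixingWrt (T : Torus2 → Torus2) (ν : Measure Torus2) : Prop :=
  ∃ m : ℕ → ℕ, StrictMono m ∧ ∀ A B : Set Torus2, MeasurableSet A → MeasurableSet B →
    Tendsto (fun n => |(ν (B ∩ (T^[m n]) ⁻¹' A)).toReal - (ν A).toReal * (ν B).toReal|)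
      atTop (𝓝 0)

/-- Lift of the translation `S_t`. -/
def Slift (t : ℝ) : ℝ × ℝ → ℝ × ℝ := fun p => (p.1 + t, p.2)

/-- `T` is ergodic with respect to `ν`: every Borel set `E` with `T⁻¹E = E` has measure `0` or `1`. -/
def IsErgodicWrt (T : Torus2 → Torus2) (ν : Measure Torus2) : Prop :=
  ∀ E : Set Torus2, MeasurableSet E → T ⁻¹' E = E → ν E = 0 ∨ ν E = 1

namespace AK

lemma proj_add_int (p : ℝ × ℝ) (m : ℤ × ℤ) :
    torusProj (p + ((m.1 : ℝ), (m.2 : ℝ))) = torusProj p := by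
  simp [torusProj]

lemma proj_surj : Function.Surjective torusProj := by
  rintro ⟨a, b⟩
  obtain ⟨x, rfl⟩ := QuotientAddGroup.mk_surjective a
  obtain ⟨y, rfl⟩ := QuotientAddGroup.mk_surjective b
  exact ⟨(x, y), rfl⟩

lemma proj_eq {p p' : ℝ × ℝ} (h : torusProj p = torusProj p') :
    ∃ m : ℤ × ℤ, p' = p + ((m.1 : ℝ), (m.2 : ℝ)) := by
  have key : ∀ x y : ℝ, (x : UnitAddCircle) = (y : UnitAddCircle) → ∃ k : ℤ, y = x + k := by
    intro x y hxy
    have : ((y - x : ℝ) : UnitAddCircle) = 0 := by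
      rw [AddCircle.coe_sub, hxy, sub_self]
    obtain ⟨k, hk⟩ := (AddCircle.coe_eq_zero_iff (1 : ℝ)).1 this
    refine ⟨k, ?_⟩
    simp at hk
    linarith
  have h1 := congrArg Prod.fst h
  have h2 := congrArg Prod.snd h
  obtain ⟨k, hk⟩ := key _ _ h1
  obtain ⟨l, hl⟩ := key _ _ h2
  exact ⟨(k, l), Prod.ext hk hl⟩

lemma proj_continuous : Continuous torusProj := by
  unfold torusProj
  exact ((AddCircle.continuous_mk' (1 : ℝ)).comp continuous_fst).prodMk
    ((AddCircle.continuous_mk' (1 : ℝ)).comp continuous_snd)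

/-- descend a map to the torus -/
def desc (F : ℝ × ℝ → ℝ × ℝ) : Torus2 → Torus2 :=
  fun z => torusProj (F (Function.surjInv proj_surj z))

lemma desc_proj {F : ℝ × ℝ → ℝ × ℝ} (hF : IntEquivariant F) (p : ℝ × ℝ) :
    torusProj (F p) = desc F (torusProj p) := by
  unfold desc
  obtain ⟨m, hm⟩ := proj_eq (Function.surjInv_eq proj_surj (torusProj p)).symm
  rw [hm, hF, proj_add_int]

lemma desc_unique {F : ℝ × ℝ → ℝ × ℝ} (hF : IntEquivariant F) {f : Torus2 → Torus2}
    (h : ∀ p, torusProj (F p) = f (torusProj p)) : desc F = f := by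
  ext1 z
  obtain ⟨p, rfl⟩ := proj_surj z
  rw [← desc_proj hF, h]

lemma desc_comp {F G : ℝ × ℝ → ℝ × ℝ} (hF : IntEquivariant F) (hG : IntEquivariant G) :
    desc (F ∘ G) = desc F ∘ desc G := by
  apply desc_unique
  · intro p m
    simp [hG p m, hF (G p) m]
  · intro p
    simp [desc_proj hF, desc_proj hG]

lemma desc_id : desc id = id := by
  apply desc_unique
  · intro p m; rfl
  · intro p; rfl

/-- the projection is a quotient map -/
lemma proj_open : IsOpenQuotientMap torusProj := by
  have h : IsOpenQuotientMap (QuotientAddGroup.mk : ℝ → UnitAddCircle) :=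
    QuotientAddGroup.isOpenQuotientMap_mk
  exact h.prodMap h

lemma desc_continuous {F : ℝ × ℝ → ℝ × ℝ} (hF : IntEquivariant F) (hc : Continuous F) :
    Continuous (desc F) := by
  rw [proj_open.isQuotientMap.continuous_iff]
  have : desc F ∘ torusProj = torusProj ∘ F := by
    ext1 p; simp [desc_proj hF]
  rw [this]
  exact proj_continuous.comp hc

/-- lifted smooth measure preserving torus diffeomorphisms -/
structure LD where
  f : ℝ × ℝ → ℝ × ℝ
  g : ℝ × ℝ → ℝ × ℝ
  cf : ContDiff ℝ (⊤ : ℕ∞) f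
  cg : ContDiff ℝ (⊤ : ℕ∞) g
  ef : IntEquivariant f
  eg : IntEquivariant g
  fg : ∀ p, f (g p) = p
  gf : ∀ p, g (f p) = p
  mp : MeasurePreserving (desc f) (volume : Measure Torus2) volume
  lip : ∃ L : NNReal, LipschitzWith L f

lemma equiv_comp {F G : ℝ × ℝ → ℝ × ℝ} (hF : IntEquivariant F) (hG : IntEquivariant G) :
    IntEquivariant (F ∘ G) := by
  intro p m
  simp [hG p m, hF (G p) m]

def LD.comp (A B : LD) : LD where
  f := A.f ∘ B.f
  g := B.g ∘ A.g
  cf := A.cf.comp B.cf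
  cg := B.cg.comp A.cg
  ef := equiv_comp A.ef B.ef
  eg := equiv_comp B.eg A.eg
  fg := fun p => by simp [A.fg, B.fg]
  gf := fun p => by simp [A.gf, B.gf]
  mp := by
    rw [desc_comp A.ef B.ef]
    exact A.mp.comp B.mp
  lip := by
    obtain ⟨L, hL⟩ := A.lip
    obtain ⟨M, hM⟩ := B.lip
    exact ⟨L * M, hL.comp hM⟩

def LD.one : LD where
  f := id
  g := id
  cf := contDiff_id
  cg := contDiff_id
  ef := fun p m => rfl
  eg := fun p m => rfl
  fg := fun p => rfl
  gf := fun p => rfl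
  mp := by rw [desc_id]; exact MeasurePreserving.id _
  lip := ⟨1, LipschitzWith.id⟩

lemma periodic_lipschitz {ψ : ℝ → ℝ} (hψ : ContDiff ℝ (⊤ : ℕ∞) ψ) (hp : Function.Periodic ψ 1) :
    ∃ L : NNReal, LipschitzWith L ψ := by
  have hd : Continuous (deriv ψ) := hψ.continuous_deriv (by simp)
  have hdp : Function.Periodic (deriv ψ) 1 := by
    intro x
    have : (fun y => ψ (y + 1)) = ψ := funext hp
    rw [← deriv_comp_add_const, this]
  obtain ⟨C, hC⟩ := (isCompact_Icc (a := (0:ℝ)) (b := 1)).exists_bound_of_continuousOn hd.continuousOn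
  refine ⟨Real.toNNReal C, lipschitzWith_of_nnnorm_deriv_le (hψ.differentiable (by simp)) ?_⟩
  intro x
  have hx : deriv ψ x = deriv ψ (Int.fract x) := by
    have := hdp.sub_int_mul_eq ⌊x⌋ (x := x)
    rw [← this]; simp
  rw [hx, ← NNReal.coe_le_coe, coe_nnnorm]
  exact (hC _ ⟨Int.fract_nonneg x, (Int.fract_lt_one x).le⟩).trans (Real.le_coe_toNNReal C)

lemma per_int {ψ : ℝ → ℝ} (hp : Function.Periodic ψ 1) (x : ℝ) (k : ℤ) : ψ (x + k) = ψ x := by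
  simpa using (hp.int_mul k) x

lemma vshear_equiv {ψ : ℝ → ℝ} (hp : Function.Periodic ψ 1) :
    IntEquivariant (fun p => (p.1, p.2 + ψ p.1)) := by
  intro p m
  simp [per_int hp]
  ring

lemma hshear_equiv {ψ : ℝ → ℝ} (hp : Function.Periodic ψ 1) :
    IntEquivariant (fun p => (p.1 + ψ p.2, p.2)) := by
  intro p m
  simp [per_int hp]
  ring

lemma vshear_mp {ψ : ℝ → ℝ} (hc : Continuous ψ) (hp : Function.Periodic ψ 1) :
    MeasurePreserving (desc (fun p => (p.1, p.2 + ψ p.1))) (volume : Measure Torus2) volume := by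
  have hp' : Function.Periodic (fun x => (ψ x : UnitAddCircle)) 1 := fun x => by simp [hp x]
  have hcont : Continuous (hp'.lift) := by
    have h : IsOpenQuotientMap (QuotientAddGroup.mk : ℝ → UnitAddCircle) :=
      QuotientAddGroup.isOpenQuotientMap_mk
    rw [h.isQuotientMap.continuous_iff]
    exact (AddCircle.continuous_mk' (1 : ℝ)).comp hc
  have : desc (fun p => (p.1, p.2 + ψ p.1)) = fun z : Torus2 => (id z.1, z.2 + hp'.lift z.1) := by
    apply desc_unique (vshear_equiv hp)
    intro p
    simp [torusProj]
  rw [this]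
  refine (MeasurePreserving.id (volume : Measure UnitAddCircle)).skew_product
    (g := fun a c => c + hp'.lift a) ?_ ?_
  · exact (continuous_snd.add (hcont.comp continuous_fst)).measurable
  · refine Filter.Eventually.of_forall fun a => ?_
    exact (measurePreserving_add_right (volume : Measure UnitAddCircle) _).map_eq

lemma hshear_mp {ψ : ℝ → ℝ} (hc : Continuous ψ) (hp : Function.Periodic ψ 1) :
    MeasurePreserving (desc (fun p => (p.1 + ψ p.2, p.2))) (volume : Measure Torus2) volume := by
  have hs : MeasurePreserving (Prod.swap : Torus2 → Torus2) volume volume :=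
    Measure.measurePreserving_swap
  have := hs.comp ((vshear_mp hc hp).comp hs)
  convert this
  apply desc_unique (hshear_equiv hp)
  intro p
  have h := desc_proj (vshear_equiv hp) p.swap
  have h2 : (torusProj p).swap = torusProj p.swap := rfl
  simp only [Function.comp, h2]
  rw [← h]
  rfl

def vshear (ψ : ℝ → ℝ) (hc : ContDiff ℝ (⊤ : ℕ∞) ψ) (hp : Function.Periodic ψ 1) : LD where
  f := fun p => (p.1, p.2 + ψ p.1)
  g := fun p => (p.1, p.2 - ψ p.1)
  cf := by fun_prop
  cg := by fun_prop
  ef := vshear_equiv hp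
  eg := by
    have := vshear_equiv (ψ := fun x => - ψ x) (fun x => by simp [hp x])
    simpa [sub_eq_add_neg] using this
  fg := fun p => by simp
  gf := fun p => by simp
  mp := vshear_mp hc.continuous hp
  lip := by
    obtain ⟨L, hL⟩ := periodic_lipschitz hc hp
    exact ⟨_, LipschitzWith.prod_fst.prodMk
      (LipschitzWith.prod_snd.add (hL.comp LipschitzWith.prod_fst))⟩

def hshear (ψ : ℝ → ℝ) (hc : ContDiff ℝ (⊤ : ℕ∞) ψ) (hp : Function.Periodic ψ 1) : LD where
  f := fun p => (p.1 + ψ p.2, p.2)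
  g := fun p => (p.1 - ψ p.2, p.2)
  cf := by fun_prop
  cg := by fun_prop
  ef := hshear_equiv hp
  eg := by
    have := hshear_equiv (ψ := fun x => - ψ x) (fun x => by simp [hp x])
    simpa [sub_eq_add_neg] using this
  fg := fun p => by simp
  gf := fun p => by simp
  mp := hshear_mp hc.continuous hp
  lip := by
    obtain ⟨L, hL⟩ := periodic_lipschitz hc hp
    exact ⟨_, (LipschitzWith.prod_fst.add (hL.comp LipschitzWith.prod_snd)).prodMk
      LipschitzWith.prod_snd⟩

/-- translation -/
def tr (t : ℝ) : LD := hshear (fun _ => t) contDiff_const (fun _ => rfl)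

@[simp] lemma tr_f (t : ℝ) (p : ℝ × ℝ) : (tr t).f p = (p.1 + t, p.2) := rfl
@[simp] lemma tr_g (t : ℝ) (p : ℝ × ℝ) : (tr t).g p = (p.1 - t, p.2) := rfl

theorem LD.inv_mp (A : LD) : MeasurePreserving (desc A.g) (volume : Measure Torus2) volume := by
  have h1 : desc A.f ∘ desc A.g = id := by
    rw [← desc_comp A.ef A.eg, ← desc_id]; congr 1; ext1 p; exact A.fg p
  have h2 : desc A.g ∘ desc A.f = id := by
    rw [← desc_comp A.eg A.ef, ← desc_id]; congr 1; ext1 p; exact A.gf p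
  have hm : Measurable (desc A.g) := (desc_continuous A.eg A.cg.continuous).measurable
  refine ⟨hm, ?_⟩
  conv_lhs => rw [← A.mp.map_eq]
  rw [Measure.map_map hm A.mp.measurable, h2, Measure.map_id]

end AK

namespace AK

/-- smooth cutoff -/
def cut (a b c d x : ℝ) : ℝ :=
  Real.smoothTransition ((x - a) / (b - a)) * Real.smoothTransition ((d - x) / (d - c))

lemma cut_smooth (a b c d : ℝ) : ContDiff ℝ (⊤ : ℕ∞) (cut a b c d) := by
  unfold cut
  have := @Real.smoothTransition.contDiff
  fun_prop

lemma cut_left {a b c d x : ℝ} (hab : a < b) (hx : x ≤ a) : cut a b c d x = 0 := by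
  unfold cut
  rw [Real.smoothTransition.zero_of_nonpos, zero_mul]
  exact div_nonpos_of_nonpos_of_nonneg (by linarith) (by linarith)

lemma cut_right {a b c d x : ℝ} (hcd : c < d) (hx : d ≤ x) : cut a b c d x = 0 := by
  unfold cut
  rw [Real.smoothTransition.zero_of_nonpos (x := (d - x) / (d - c)), mul_zero]
  exact div_nonpos_of_nonpos_of_nonneg (by linarith) (by linarith)

lemma cut_mid {a b c d x : ℝ} (hab : a < b) (hcd : c < d) (h1 : b ≤ x) (h2 : x ≤ c) :
    cut a b c d x = 1 := by
  unfold cut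
  rw [Real.smoothTransition.one_of_one_le, Real.smoothTransition.one_of_one_le, one_mul]
  · rw [le_div_iff₀ (by linarith)]; linarith
  · rw [le_div_iff₀ (by linarith)]; linarith

lemma cut_nonneg (a b c d x : ℝ) : 0 ≤ cut a b c d x :=
  mul_nonneg (Real.smoothTransition.nonneg _) (Real.smoothTransition.nonneg _)

lemma cut_le_one (a b c d x : ℝ) : cut a b c d x ≤ 1 :=
  mul_le_one₀ (Real.smoothTransition.le_one _) (Real.smoothTransition.nonneg _)
    (Real.smoothTransition.le_one _)

/-- periodization -/
def per (F : ℝ → ℝ) (x : ℝ) : ℝ := F (Int.fract x)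

lemma per_periodic (F : ℝ → ℝ) : Function.Periodic (per F) 1 := by
  intro x; simp [per]

lemma per_smooth {F : ℝ → ℝ} (hF : ContDiff ℝ (⊤ : ℕ∞) F) {a d : ℝ} (ha : 0 < a) (hd : d < 1)
    (h1 : ∀ x ≤ a, F x = 0) (h2 : ∀ x, d ≤ x → F x = 0) : ContDiff ℝ (⊤ : ℕ∞) (per F) := by
  rw [contDiff_iff_contDiffAt]
  intro x
  rcases (Int.fract_nonneg x).eq_or_lt with h0 | h0
  · have hx : x = ⌊x⌋ := by
      have := Int.floor_add_fract x; linarith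
    have : per F =ᶠ[𝓝 x] fun _ => 0 := by
      have hm : Set.Ioo (x - (1 - d)) (x + a) ∈ 𝓝 x := Ioo_mem_nhds (by linarith) (by linarith)
      filter_upwards [hm] with y hy
      unfold per
      by_cases hyx : x ≤ y
      · apply h1
        have h3 := Int.fract_nonneg y
        have h4 : (⌊x⌋ : ℝ) ≤ ⌊y⌋ := by exact_mod_cast Int.floor_mono hyx
        have h5 := Int.floor_add_fract y
        linarith [hy.2]
      · apply h2
        have h3 := Int.fract_lt_one y
        push Not at hyx
        have h4 : ⌊y⌋ + 1 ≤ ⌊x⌋ := by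
          have : ⌊y⌋ < ⌊x⌋ := by
            rw [Int.floor_lt]; rw [← hx]; exact hyx
          omega
        have h4' : (⌊y⌋ : ℝ) + 1 ≤ ⌊x⌋ := by exact_mod_cast h4
        have h5 := Int.floor_add_fract y
        linarith [hy.1]
    exact contDiffAt_const.congr_of_eventuallyEq this
  · have : per F =ᶠ[𝓝 x] fun y => F (y - ⌊x⌋) := by
      have h5 := Int.floor_add_fract x
      have hm : Set.Ioo (⌊x⌋ : ℝ) (⌊x⌋ + 1) ∈ 𝓝 x :=
        Ioo_mem_nhds (by linarith) (by linarith [Int.fract_lt_one x])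
      filter_upwards [hm] with y hy
      unfold per
      have : ⌊y⌋ = ⌊x⌋ := by
        rw [Int.floor_eq_iff]; exact ⟨hy.1.le, hy.2⟩
      rw [Int.fract, this]
    refine ContDiffAt.congr_of_eventuallyEq ?_ this
    exact (hF.comp (contDiff_id.sub contDiff_const)).contDiffAt

lemma per_eq (F : ℝ → ℝ) {x : ℝ} (h0 : 0 ≤ x) (h1 : x < 1) : per F x = F x := by
  unfold per; rw [Int.fract_eq_self.2 ⟨h0, h1⟩]

lemma abs_int_le {G : ℝ → ℝ} {C a b : ℝ} (hab : a ≤ b) (h : ∀ x, a ≤ x → x ≤ b → |G x| ≤ C) :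
    |∫ x in a..b, G x| ≤ C * (b - a) := by
  have := intervalIntegral.norm_integral_le_of_norm_le_const (a := a) (b := b) (f := G) (C := C)
    (by
      intro x hx
      rw [Set.uIoc_of_le hab] at hx
      exact h x hx.1.le hx.2)
  rwa [abs_of_nonneg (by linarith : 0 ≤ b - a), Real.norm_eq_abs] at this

lemma int_periodic_bound {β : ℝ → ℝ} (hβ : Continuous β) (hp : Function.Periodic β 1)
    (hb : ∀ y, |β y| ≤ 2) (h0 : ∫ y in (0:ℝ)..1, β y = 0) (c d : ℝ) :
    |∫ y in c..d, β y| ≤ 2 := by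
  have hi : ∀ a b : ℝ, IntervalIntegrable β volume a b := fun a b => hβ.intervalIntegrable a b
  have h1 := hp.intervalIntegral_add_zsmul_eq ⌊d - c⌋ c (fun a b => hi a b)
  have h2 : ∫ x in c..c + 1, β x = 0 := by
    rw [hp.intervalIntegral_add_eq c 0]; simpa using h0
  rw [h2, smul_zero] at h1
  have h3 := intervalIntegral.integral_add_adjacent_intervals (hi c (c + ⌊d - c⌋ • (1:ℝ)))
    (hi (c + ⌊d - c⌋ • (1:ℝ)) d)
  rw [← h3, h1, zero_add]
  have hfl := Int.floor_le (d - c)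
  have hfl2 := Int.lt_floor_add_one (d - c)
  have hle : c + ⌊d - c⌋ • (1:ℝ) ≤ d := by simp; linarith
  refine (abs_int_le hle (fun x _ _ => hb x)).trans ?_
  simp
  linarith

lemma Y_int {Y : ℝ → ℝ} (hY : Continuous Y) {δ s0 u v Λ : ℝ} (hδ0 : 0 < δ) (hδ : δ ≤ 1) (h0 : 0 < s0)
    (hs : s0 ≤ δ / 8) (hsu : s0 ≤ u) (huv : u ≤ v) (hv : v ≤ 1) (hΛ : 0 < Λ)
    (hY0 : ∀ s, 0 ≤ s → s ≤ s0 → |Y s| ≤ δ)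
    (hY1 : ∀ s, u ≤ s → s ≤ v → Y s = Λ * s)
    (hsm : 2 * (u - s0) + 2 / Λ + 2 * (1 - v) ≤ δ * s0)
    {β : ℝ → ℝ} (hβ : Continuous β) (hp : Function.Periodic β 1)
    (hb : ∀ y, |β y| ≤ 2) (hβ0 : ∫ y in (0:ℝ)..1, β y = 0) {δ' : ℝ}
    (hβδ : ∀ y, |y| ≤ δ → |β y| ≤ δ') :
    (∀ σ, 0 ≤ σ → σ ≤ 1 → |∫ s in (0:ℝ)..σ, β (Y s)| ≤ (δ' + δ) * σ) ∧
    |∫ s in (0:ℝ)..1, β (Y s)| ≤ δ := by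
  have hc : Continuous fun s => β (Y s) := hβ.comp hY
  have hi : ∀ a b : ℝ, IntervalIntegrable (fun s => β (Y s)) volume a b :=
    fun a b => hc.intervalIntegrable a b
  have hΛ2 : 0 < 2 / Λ := by positivity
  have tail : ∀ σ, s0 ≤ σ → σ ≤ 1 → |∫ s in s0..σ, β (Y s)| ≤ δ * s0 := by
    intro σ h1 h2
    have e1 := intervalIntegral.integral_add_adjacent_intervals (hi s0 (min σ u)) (hi (min σ u) (min σ v))
    have e2 := intervalIntegral.integral_add_adjacent_intervals (hi s0 (min σ v)) (hi (min σ v) σ)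
    have b1 : |∫ s in s0..min σ u, β (Y s)| ≤ 2 * (min σ u - s0) :=
      abs_int_le (le_min h1 hsu) (fun x _ _ => hb _)
    have b3 : |∫ s in min σ v..σ, β (Y s)| ≤ 2 * (σ - min σ v) :=
      abs_int_le (min_le_left _ _) (fun x _ _ => hb _)
    have b2 : |∫ s in min σ u..min σ v, β (Y s)| ≤ 2 / Λ := by
      rcases le_total σ u with hu | hu
      · rw [min_eq_left hu, min_eq_left (hu.trans huv)]; simp [hΛ2.le]
      · rw [min_eq_right hu]
        have : ∫ s in u..min σ v, β (Y s) = ∫ s in u..min σ v, β (Λ * s) := by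
          apply intervalIntegral.integral_congr
          intro s hs
          rw [Set.uIcc_of_le (le_min hu huv)] at hs
          simp only
          rw [hY1 s hs.1 (hs.2.trans (min_le_right _ _))]
        rw [this, intervalIntegral.integral_comp_mul_left _ hΛ.ne', smul_eq_mul, abs_mul,
          abs_of_pos (inv_pos.2 hΛ), div_eq_inv_mul]
        exact mul_le_mul_of_nonneg_left (int_periodic_bound hβ hp hb hβ0 _ _) (inv_pos.2 hΛ).le
    have b1' : min σ u - s0 ≤ u - s0 := by linarith [min_le_right σ u]
    have b3' : σ - min σ v ≤ 1 - v := by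
      rcases le_total σ v with h | h
      · rw [min_eq_left h]; linarith
      · rw [min_eq_right h]; linarith
    rw [← e2, ← e1]
    refine (abs_add_le _ _).trans ?_
    refine (add_le_add (abs_add_le _ _) le_rfl).trans ?_
    linarith
  have hδ' : 0 ≤ δ' := (abs_nonneg _).trans (hβδ 0 (by simp [hδ0.le]))
  have hs01 : s0 ≤ 1 := by linarith
  refine ⟨?_, ?_⟩
  · intro σ h1 h2
    rcases le_total σ s0 with h | h
    · refine (abs_int_le h1 (C := δ') ?_).trans ?_
      · intro x hx1 hx2
        exact hβδ _ (hY0 x hx1 (hx2.trans h))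
      · nlinarith
    · have e1 := intervalIntegral.integral_add_adjacent_intervals (hi 0 s0) (hi s0 σ)
      have b1 : |∫ s in (0:ℝ)..s0, β (Y s)| ≤ δ' * (s0 - 0) :=
        abs_int_le h0.le (fun x hx1 hx2 => hβδ _ (hY0 x hx1 hx2))
      rw [← e1]
      refine (abs_add_le _ _).trans ((add_le_add b1 (tail σ h h2)).trans ?_)
      nlinarith
  · have e1 := intervalIntegral.integral_add_adjacent_intervals (hi 0 s0) (hi s0 1)
    have b1 : |∫ s in (0:ℝ)..s0, β (Y s)| ≤ 2 * (s0 - 0) :=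
      abs_int_le h0.le (fun x hx1 hx2 => hb _)
    rw [← e1]
    refine (abs_add_le _ _).trans ((add_le_add b1 (tail 1 hs01 le_rfl)).trans ?_)
    nlinarith

lemma per_extend {G : ℝ → ℝ} (hG : Continuous G) (hp : Function.Periodic G 1) {c : ℝ}
    (h : ∀ σ, 0 ≤ σ → σ ≤ 1 → |∫ s in (0:ℝ)..σ, G s| ≤ c * σ) (σ : ℝ) (hσ : 0 ≤ σ) :
    |∫ s in (0:ℝ)..σ, G s| ≤ c * σ := by
  have hi : ∀ a b : ℝ, IntervalIntegrable G volume a b := fun a b => hG.intervalIntegrable a b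
  have key : ∀ n : ℕ, ∀ σ, (n : ℝ) ≤ σ → σ ≤ n + 1 → |∫ s in (0:ℝ)..σ, G s| ≤ c * σ := by
    intro n
    induction n with
    | zero => intro σ h1 h2; exact h σ (by simpa using h1) (by simpa using h2)
    | succ n ih =>
      intro σ h1 h2
      push_cast at h1 h2
      have e1 := intervalIntegral.integral_add_adjacent_intervals (hi 0 (σ - 1)) (hi (σ - 1) σ)
      have e2 := hp.intervalIntegral_add_eq (σ - 1) 0
      simp only [sub_add_cancel, zero_add] at e2
      rw [← e1, e2]
      refine (abs_add_le _ _).trans ((add_le_add (ih (σ - 1) (by linarith) (by linarith))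
        (h 1 zero_le_one le_rfl)).trans ?_)
      linarith
  exact key ⌊σ⌋₊ σ (Nat.floor_le hσ) (Nat.lt_floor_add_one σ).le

set_option maxHeartbeats 2000000 in
theorem K_exists {δ : ℝ} (hδ0 : 0 < δ) (hδ : δ ≤ 1) : ∃ θ b ψ : ℝ → ℝ,
    ContDiff ℝ (⊤ : ℕ∞) θ ∧ ContDiff ℝ (⊤ : ℕ∞) b ∧ ContDiff ℝ (⊤ : ℕ∞) ψ ∧
    Function.Periodic θ 1 ∧ Function.Periodic b 1 ∧ Function.Periodic ψ 1 ∧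
    θ 0 = 0 ∧ b 0 = 0 ∧ ψ 0 = 0 ∧ (∀ x, |θ x| ≤ δ) ∧ (∀ x, δ ≤ Int.fract x → ψ x = 0) ∧
    ∀ β : ℝ → ℝ, Continuous β → Function.Periodic β 1 → (∀ y, |β y| ≤ 2) →
      (∫ y in (0:ℝ)..1, β y = 0) → ∀ δ' : ℝ, (∀ y, |y| ≤ δ → |β y| ≤ δ') →
      (∀ σ, 0 ≤ σ → |∫ s in (0:ℝ)..σ, β (θ s + ψ (s + b (θ s)))| ≤ (δ' + δ) * σ) ∧
      |∫ s in (0:ℝ)..1, β (θ s + ψ (s + b (θ s)))| ≤ δ := by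
  -- parameters
  set ω : ℝ := δ / 2 with hω
  set s0 : ℝ := δ / 8 with hs0
  set d1 : ℝ := δ / 8 with hd1
  set a : ℝ := ω * s0 * δ / 64 with ha
  set η : ℝ := δ / 4 with hη
  set Λ : ℝ := 8 / (δ * s0) with hΛ
  set M : ℝ := (Λ - η * (1 - ω)) / ω with hM
  have hω0 : 0 < ω := by positivity
  have hs00 : 0 < s0 := by positivity
  have hη0 : 0 < η := by positivity
  have hd0 : 0 < d1 := by positivity
  have ha0 : 0 < a := by positivity
  have hω1 : ω ≤ 1 / 2 := by rw [hω]; linarith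
  have hs01 : s0 ≤ 1 / 8 := by rw [hs0]; linarith
  have hd11 : d1 ≤ 1 / 8 := by rw [hd1]; linarith
  have hη1 : η ≤ 1 / 4 := by rw [hη]; linarith
  have hωs : ω * s0 ≤ 1 / 16 := by nlinarith
  have haω : a ≤ ω * s0 / 64 := by
    rw [ha]; have : 0 < ω * s0 := by positivity
    nlinarith
  have has : a ≤ s0 * δ / 64 := by
    rw [ha]; have : 0 < s0 * δ := by positivity
    nlinarith
  have ha1 : a ≤ 1 / 1024 := by linarith
  have hΛ0 : 0 < Λ := by positivity
  -- functions
  set g0 : ℝ → ℝ := fun x => (1 - ω) * x * cut a (2 * a) (1 - 2 * a) (1 - a) x with hg0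
  set θ0 : ℝ → ℝ := fun x => η * g0 x with hθ0
  set b0 : ℝ → ℝ := fun z => -((z - 1 / 2) / η) * cut (1/8) (1/4) (3/4) (7/8) z with hb0
  set ψ0 : ℝ → ℝ := fun w => M * w * cut (ω * s0) (ω * (s0 * (1 + d1))) (ω * (1 - 2 * a)) ω w with hψ0
  have i1 : ω * s0 < ω * (s0 * (1 + d1)) := by nlinarith [mul_pos hω0 (mul_pos hs00 hd0)]
  have i2 : ω * (1 - 2 * a) < ω := by nlinarith
  have cθ : ContDiff ℝ (⊤ : ℕ∞) (per θ0) := by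
    refine per_smooth (a := a) (d := 1 - a) ?_ ha0 (by linarith) ?_ ?_
    · have := cut_smooth a (2 * a) (1 - 2 * a) (1 - a)
      simp only [hθ0, hg0]; fun_prop
    · intro x hx; simp [hθ0, hg0, cut_left (by linarith : a < 2 * a) hx]
    · intro x hx; simp [hθ0, hg0, cut_right (by linarith : 1 - 2 * a < 1 - a) hx]
  have cb : ContDiff ℝ (⊤ : ℕ∞) (per b0) := by
    refine per_smooth (a := 1/8) (d := 7/8) ?_ (by norm_num) (by norm_num) ?_ ?_
    · have := cut_smooth (1/8) (1/4) (3/4) (7/8)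
      simp only [hb0]; fun_prop
    · intro x hx
      simp only [hb0]; rw [cut_left (by norm_num) hx, mul_zero]
    · intro x hx
      simp only [hb0]; rw [cut_right (by norm_num) hx, mul_zero]
  have cψ : ContDiff ℝ (⊤ : ℕ∞) (per ψ0) := by
    refine per_smooth (a := ω * s0) (d := ω) ?_ (by positivity) (by linarith) ?_ ?_
    · have := cut_smooth (ω * s0) (ω * (s0 * (1 + d1))) (ω * (1 - 2 * a)) ω
      simp only [hψ0]; fun_prop
    · intro x hx; simp only [hψ0]; rw [cut_left i1 hx, mul_zero]
    · intro x hx; simp only [hψ0]; rw [cut_right i2 hx, mul_zero]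
  set b : ℝ → ℝ := fun y => per b0 (y + 1 / 2) with hb
  have cb' : ContDiff ℝ (⊤ : ℕ∞) b := by simp only [hb]; fun_prop
  have pb : Function.Periodic b 1 := by
    intro y; simp only [hb]
    rw [show y + 1 + 1 / 2 = (y + 1 / 2) + 1 by ring]; exact per_periodic b0 _
  have g0_bd : ∀ x, 0 ≤ x → x ≤ 1 → 0 ≤ g0 x ∧ g0 x ≤ x := by
    intro x h0 h1
    have c0 := cut_nonneg a (2 * a) (1 - 2 * a) (1 - a) x
    have c1 := cut_le_one a (2 * a) (1 - 2 * a) (1 - a) x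
    have h2 : 0 ≤ (1 - ω) * x := mul_nonneg (by linarith) h0
    refine ⟨mul_nonneg h2 c0, ?_⟩
    calc g0 x ≤ (1 - ω) * x * 1 := mul_le_mul_of_nonneg_left c1 h2
      _ ≤ x := by nlinarith
  have bval : ∀ t, 0 ≤ t → t ≤ 1 → b (η * t) = - t := by
    intro t h0 h1
    have h2 : η * t ≤ 1 / 4 := by nlinarith
    have h3 : 0 ≤ η * t := by positivity
    simp only [hb]
    rw [per_eq _ (by linarith) (by linarith)]
    simp only [hb0]
    rw [cut_mid (by norm_num) (by norm_num) (by linarith) (by linarith)]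
    field_simp
    ring
  have bθ : ∀ s, 0 ≤ s → s < 1 → b (per θ0 s) = - g0 s := by
    intro s h0 h1
    rw [per_eq _ h0 h1]
    obtain ⟨h2, h3⟩ := g0_bd s h0 h1.le
    exact bval _ h2 (by linarith)
  have θbd : ∀ x, |per θ0 x| ≤ δ := by
    intro x
    obtain ⟨h2, h3⟩ := g0_bd (Int.fract x) (Int.fract_nonneg x) (Int.fract_lt_one x).le
    have := Int.fract_lt_one x
    simp only [per, hθ0]
    rw [abs_of_nonneg (by positivity)]
    nlinarith
  have ψzero : ∀ w, 0 ≤ w → w ≤ ω * s0 → per ψ0 w = 0 := by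
    intro w h0 h1
    rw [per_eq _ h0 (by linarith)]
    simp only [hψ0]; rw [cut_left i1 h1, mul_zero]
  have g0mid : ∀ s, 2 * a ≤ s → s ≤ 1 - 2 * a → g0 s = (1 - ω) * s := by
    intro s h1 h2
    simp only [hg0]; rw [cut_mid (by linarith) (by linarith) h1 h2, mul_one]
  refine ⟨per θ0, b, per ψ0, cθ, cb', cψ, per_periodic _, pb, per_periodic _, ?_, ?_, ?_, θbd, ?_, ?_⟩
  · simp [per, hθ0, hg0]
  · have := bval 0 le_rfl zero_le_one
    simpa using this
  · simp [per, hψ0]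
  · intro x hx
    simp only [per, hψ0]; rw [cut_right i2 (by linarith), mul_zero]
  · intro β hβ hp hb2 hβ0 δ' hδ'
    set Y : ℝ → ℝ := fun s => per θ0 s + per ψ0 (s + b (per θ0 s)) with hY
    have hYc : Continuous Y := by
      have h1 := cθ.continuous
      have h2 := cψ.continuous
      have h3 := cb'.continuous
      simp only [hY]; fun_prop
    have hYp : Function.Periodic Y 1 := by
      intro s
      simp only [hY]
      rw [per_periodic θ0 s, show s + 1 + b (per θ0 s) = (s + b (per θ0 s)) + 1 by ring,
        per_periodic ψ0]
    have main := Y_int hYc (δ := δ) (s0 := s0) (u := s0 * (1 + d1)) (v := 1 - 2 * a) (Λ := Λ)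
      hδ0 hδ hs00 le_rfl (by nlinarith) (by nlinarith) (by linarith) hΛ0 ?_ ?_ ?_ hβ hp hb2 hβ0 hδ'
    · refine ⟨?_, main.2⟩
      exact per_extend (hβ.comp hYc) (fun s => by simp only [Function.comp]; rw [hYp s]) main.1
    · intro s h0 h1
      have hs1 : s < 1 := by linarith
      have : per ψ0 (s + b (per θ0 s)) = 0 := by
        rw [bθ s h0 hs1]
        rcases le_total s (2 * a) with h | h
        · obtain ⟨h2, h3⟩ := g0_bd s h0 hs1.le
          exact ψzero _ (by linarith) (by linarith)
        · rw [g0mid s h (by linarith)]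
          apply ψzero
          · nlinarith
          · nlinarith
      simp only [hY]
      rw [this, add_zero]
      exact θbd s
    · intro s h1 h2
      have hs2 : s0 ≤ s := by nlinarith
      have hs3 : 2 * a ≤ s := by nlinarith
      simp only [hY]
      rw [bθ s (by linarith) (by linarith), per_eq θ0 (by linarith) (by linarith)]
      simp only [hθ0]
      rw [g0mid s hs3 h2, show s + -((1 - ω) * s) = ω * s by ring,
        per_eq ψ0 (by nlinarith) (by nlinarith)]
      simp only [hψ0]
      rw [cut_mid i1 i2 (mul_le_mul_of_nonneg_left h1 hω0.le) (mul_le_mul_of_nonneg_left h2 hω0.le),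
        hM]
      field_simp
      ring
    · have e1 : 2 / Λ = δ * s0 / 4 := by rw [hΛ]; field_simp; norm_num
      rw [e1]
      have e2 : s0 * d1 = δ * s0 / 8 := by rw [hd1]; ring
      nlinarith

end AK

namespace AK

lemma per_nat {Φ : ℝ → ℝ} (hp : Function.Periodic Φ 1) (x : ℝ) (k : ℕ) : Φ (x + k) = Φ x := by
  simpa using (hp.nat_mul k) x

lemma sum_coprime {Φ : ℝ → ℝ} (hp : Function.Periodic Φ 1) {p q : ℕ} (hq : 0 < q)
    (hpq : Nat.Coprime p q) (x : ℝ) :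
    ∑ r ∈ Finset.range q, Φ (x + r * (p / q : ℝ)) = ∑ r ∈ Finset.range q, Φ (x + r / q) := by
  have hq' : (q : ℝ) ≠ 0 := by positivity
  refine Finset.sum_nbij (fun r => r * p % q) ?_ ?_ ?_ ?_
  · intro r hr
    simp [Nat.mod_lt _ hq]
  · intro r hr s hs h
    simp only [Finset.coe_range, Set.mem_Iio] at hr hs
    have h' : r * p ≡ s * p [MOD q] := h
    have := Nat.ModEq.cancel_right_of_coprime (by simpa [Nat.coprime_comm] using hpq.symm) h'
    exact Nat.ModEq.eq_of_lt_of_lt this hr hs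
  · refine Finset.surjOn_of_injOn_of_card_le _ ?_ ?_ le_rfl
    · intro r hr
      simp [Nat.mod_lt _ hq]
    · intro r hr s hs h
      simp only [Finset.coe_range, Set.mem_Iio] at hr hs
      have h' : r * p ≡ s * p [MOD q] := h
      have := Nat.ModEq.cancel_right_of_coprime (by simpa [Nat.coprime_comm] using hpq.symm) h'
      exact Nat.ModEq.eq_of_lt_of_lt this hr hs
  · intro r hr
    have h := Nat.mod_add_div (r * p) q
    have h2 : (r : ℝ) * p = ((r * p % q : ℕ) : ℝ) + q * ((r * p / q : ℕ) : ℝ) := by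
      exact_mod_cast h.symm
    have : x + r * (p / q : ℝ) = (x + ((r * p % q : ℕ) : ℝ) / q) + ((r * p / q : ℕ) : ℝ) := by
      field_simp
      linarith
    rw [this, per_nat hp]

lemma block_int {Φ G : ℝ → ℝ} (hG : Continuous G) (hp : Function.Periodic Φ 1) {L : NNReal}
    (hL : LipschitzWith L Φ) {p q : ℕ} (hq : 0 < q) (hpq : Nat.Coprime p q) {κ ε : ℝ} (hε : 0 < ε)
    (hκ : ∀ x, |∑ r ∈ Finset.range q, Φ (x + r / q) - q * G x| ≤ q * κ) (m : ℕ) :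
    |∑ r ∈ Finset.range q, Φ (((q * m + r : ℕ) : ℝ) * (p / q + ε))
      - ε⁻¹ * ∫ x in (q * m * ε)..(q * (m + 1) * ε), G x| ≤ q * (κ + L * (q * ε)) := by
  have hq' : (0 : ℝ) < q := by positivity
  set S := ∑ r ∈ Finset.range q, Φ (((q * m + r : ℕ) : ℝ) * (p / q + ε)) with hS
  have hle : (q * m * ε : ℝ) ≤ q * (m + 1) * ε := by nlinarith [mul_pos hq' hε]
  have hpt : ∀ x, (q * m * ε : ℝ) ≤ x → x ≤ q * (m + 1) * ε →
      |S - q * G x| ≤ q * (κ + L * (q * ε)) := by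
    intro x h1 h2
    have hA : |S - ∑ r ∈ Finset.range q, Φ (x + r * (p / q : ℝ))| ≤ q * (L * (q * ε)) := by
      rw [hS, ← Finset.sum_sub_distrib]
      refine (Finset.abs_sum_le_sum_abs _ _).trans ?_
      refine (Finset.sum_le_card_nsmul _ _ (L * (q * ε)) ?_).trans ?_
      · intro r hr
        have hr' : (r : ℝ) + 1 ≤ q := by
          have := Finset.mem_range.1 hr
          exact_mod_cast this
        have hr0 : (0:ℝ) ≤ r := by positivity
        have e : ((q * m + r : ℕ) : ℝ) * (p / q + ε)
            = (((q * m + r : ℕ) : ℝ) * ε + r * (p / q : ℝ)) + ((m * p : ℕ) : ℝ) := by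
          push_cast; field_simp; ring
        rw [e, per_nat hp]
        have := hL.dist_le_mul (((q * m + r : ℕ) : ℝ) * ε + r * (p / q : ℝ)) (x + r * (p / q : ℝ))
        rw [Real.dist_eq, Real.dist_eq] at this
        refine this.trans (mul_le_mul_of_nonneg_left ?_ L.2)
        rw [abs_le]; push_cast
        constructor
        · nlinarith
        · nlinarith
      · simp
    rw [sum_coprime hp hq hpq] at hA
    have := abs_add_le (S - ∑ r ∈ Finset.range q, Φ (x + r / q))
      (∑ r ∈ Finset.range q, Φ (x + r / q) - q * G x)
    rw [sub_add_sub_cancel] at this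
    have h3 := hκ x
    nlinarith
  have hhint : ∫ x in (q * m * ε : ℝ)..(q * (m + 1) * ε), (S - q * G x)
      = q * ε * S - q * ∫ x in (q * m * ε : ℝ)..(q * (m + 1) * ε), G x := by
    rw [intervalIntegral.integral_sub (by simp) ((hG.intervalIntegrable _ _).const_mul _)]
    simp only [intervalIntegral.integral_const, intervalIntegral.integral_const_mul, smul_eq_mul]
    ring
  have hb := abs_int_le hle hpt
  rw [hhint] at hb
  have e2 : q * ε * S - q * ∫ x in (q * m * ε : ℝ)..(q * (m + 1) * ε), G x
      = (q * ε) * (S - ε⁻¹ * ∫ x in (q * m * ε)..(q * (m + 1) * ε), G x) := by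
    field_simp
  rw [e2, abs_mul, abs_of_pos (mul_pos hq' hε)] at hb
  have e3 : q * (κ + L * (q * ε)) * (q * (m + 1) * ε - q * m * ε)
      = (q * ε) * (q * (κ + L * (q * ε))) := by ring
  rw [e3] at hb
  exact le_of_mul_le_mul_left hb (mul_pos hq' hε)

lemma drift {Φ G : ℝ → ℝ} (hG : Continuous G) (hp : Function.Periodic Φ 1) {L : NNReal}
    (hL : LipschitzWith L Φ) (hΦ : ∀ x, |Φ x| ≤ 1)
    {p q : ℕ} (hq : 0 < q) (hpq : Nat.Coprime p q) {κ ε ρ c : ℝ} (hε : 0 < ε)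
    (hκ : ∀ x, |∑ r ∈ Finset.range q, Φ (x + r / q) - q * G x| ≤ q * κ)
    (hκ0 : 0 ≤ κ) (hρ0 : 0 ≤ ρ) (hc : |c| ≤ 1)
    (hρ : ∀ σ, 0 ≤ σ → |∫ x in (0:ℝ)..σ, (G x - c)| ≤ ρ * σ) (N : ℕ) :
    |∑ j ∈ Finset.range N, Φ (j * (p / q + ε)) - N * c| ≤ N * (κ + ρ + L * (q * ε)) + 2 * q := by
  have hq' : (0 : ℝ) < q := by positivity
  have hfull : ∀ M : ℕ, |∑ j ∈ Finset.range (q * M), Φ (j * (p / q + ε))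
      - ε⁻¹ * ∫ x in (0:ℝ)..(q * M * ε), G x| ≤ q * M * (κ + L * (q * ε)) := by
    intro M
    induction M with
    | zero => simp
    | succ M ih =>
      have e1 := intervalIntegral.integral_add_adjacent_intervals
        (hG.intervalIntegrable (μ := volume) 0 (q * M * ε))
        (hG.intervalIntegrable (μ := volume) (q * M * ε) (q * (M + 1) * ε))
      have hb := block_int hG hp hL hq hpq hε hκ M
      rw [mul_add, mul_one, Finset.sum_range_add]
      push_cast at hb ⊢
      rw [← e1]
      have := abs_add_le (∑ j ∈ Finset.range (q * M), Φ (j * (p / q + ε))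
        - ε⁻¹ * ∫ x in (0:ℝ)..(q * M * ε), G x)
        (∑ r ∈ Finset.range q, Φ ((q * M + r : ℝ) * (p / q + ε))
      - ε⁻¹ * ∫ x in (q * M * ε)..(q * (M + 1) * ε), G x)
      refine le_trans (le_of_eq ?_) (this.trans ((add_le_add ih hb).trans (le_of_eq ?_)))
      · congr 1; ring
      · ring
  set M := N / q with hM
  set R := N % q with hR
  have hN : N = q * M + R := (Nat.div_add_mod N q).symm
  have hRq : R < q := Nat.mod_lt _ hq
  have hNr : (N : ℝ) = q * M + R := by exact_mod_cast hN
  have hRq' : (R : ℝ) ≤ q := by exact_mod_cast hRq.le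
  have hR0 : (0 : ℝ) ≤ R := by positivity
  have h1 := hfull M
  have h2 := hρ (q * M * ε) (by positivity)
  rw [intervalIntegral.integral_sub (hG.intervalIntegrable _ _) (by simp)] at h2
  simp only [intervalIntegral.integral_const, sub_zero, smul_eq_mul] at h2
  have h2'' : |ε⁻¹ * (∫ x in (0:ℝ)..(q * M * ε), G x) - q * M * c| ≤ ρ * (q * M) := by
    have e : ε⁻¹ * (∫ x in (0:ℝ)..(q * M * ε), G x) - q * M * c
        = ε⁻¹ * ((∫ x in (0:ℝ)..(q * M * ε), G x) - q * M * ε * c) := by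
      field_simp
    rw [e, abs_mul, abs_of_pos (inv_pos.2 hε)]
    refine (mul_le_mul_of_nonneg_left h2 (inv_pos.2 hε).le).trans (le_of_eq ?_)
    field_simp
  have h3 : |∑ r ∈ Finset.range R, Φ (((q * M + r : ℕ) : ℝ) * (p / q + ε))| ≤ R := by
    refine (Finset.abs_sum_le_sum_abs _ _).trans ?_
    refine (Finset.sum_le_card_nsmul _ _ 1 fun r _ => hΦ _).trans ?_
    simp
  have h4 : |(R : ℝ) * c| ≤ R := by
    rw [abs_mul, abs_of_nonneg hR0]
    nlinarith
  have hs : ∑ j ∈ Finset.range N, Φ (j * (p / q + ε))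
      = ∑ j ∈ Finset.range (q * M), Φ (j * (p / q + ε))
        + ∑ r ∈ Finset.range R, Φ (((q * M + r : ℕ) : ℝ) * (p / q + ε)) := by
    conv_lhs => rw [hN, Finset.sum_range_add]
  have h5 : 0 ≤ R * (κ + ρ + L * (q * ε)) := by
    have := L.2
    positivity
  rw [hs, hNr]
  rw [abs_le] at *
  constructor <;> nlinarith

end AK

namespace AK

lemma param_close {Γ : ℝ × (ℝ × ℝ) → ℝ × ℝ} (hΓ : ContDiff ℝ (⊤ : ℕ∞) Γ) {t0 : ℝ}
    (h0 : ∀ z, Γ (t0, z) = 0)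
    (hper : ∀ t z, ∀ m : ℤ × ℤ, Γ (t, z + ((m.1 : ℝ), (m.2 : ℝ))) = Γ (t, z))
    {δ : ℝ} (hδ : 0 < δ) (k : ℕ) :
    ∀ᶠ t in 𝓝 t0, ∀ z, ‖iteratedFDeriv ℝ k (fun z => Γ (t, z)) z‖ ≤ δ := by
  have hform : ∀ t z, iteratedFDeriv ℝ k (fun z => Γ (t, z)) z =
      (iteratedFDeriv ℝ k Γ (t, z)).compContinuousLinearMap
        (fun _ => ContinuousLinearMap.inr ℝ ℝ (ℝ × ℝ)) := by
    intro t z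
    have e1 : (fun z => Γ (t, z)) = (fun w => Γ (w + (t, 0))) ∘ (ContinuousLinearMap.inr ℝ ℝ (ℝ × ℝ)) := by
      ext1 z; simp
    rw [e1, ContinuousLinearMap.iteratedFDeriv_comp_right (n := (⊤ : ℕ∞)) _ _ _ (by exact_mod_cast le_top)]
    · rw [iteratedFDeriv_comp_add_right]
      simp
    · fun_prop
  have hcont : Continuous fun w : ℝ × (ℝ × ℝ) => ‖iteratedFDeriv ℝ k (fun z => Γ (w.1, z)) w.2‖ := by
    have : (fun w : ℝ × (ℝ × ℝ) => ‖iteratedFDeriv ℝ k (fun z => Γ (w.1, z)) w.2‖)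
      = fun w => ‖ContinuousMultilinearMap.compContinuousLinearMapL (F := ℝ × ℝ)
          (fun _ : Fin k => ContinuousLinearMap.inr ℝ ℝ (ℝ × ℝ)) (iteratedFDeriv ℝ k Γ w)‖ := by
      ext1 w; rw [hform]; rfl
    rw [this]
    have h2 : Continuous (iteratedFDeriv ℝ k Γ) :=
      hΓ.continuous_iteratedFDeriv (by exact_mod_cast le_top)
    exact ((ContinuousLinearMap.continuous _).comp h2).norm
  have hz : ∀ z, iteratedFDeriv ℝ k (fun z => Γ (t0, z)) z = 0 := by
    intro z
    have : (fun z => Γ (t0, z)) = fun _ => 0 := funext h0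
    rw [this]; simp
  have hK : IsCompact (Set.Icc (0:ℝ) 1 ×ˢ Set.Icc (0:ℝ) 1) := isCompact_Icc.prod isCompact_Icc
  have hev := hK.eventually_forall_of_forall_eventually (x₀ := t0)
    (P := fun t z => ‖iteratedFDeriv ℝ k (fun z => Γ (t, z)) z‖ ≤ δ) (by
      intro z _
      have := hcont.tendsto (t0, z)
      simp only [hz, norm_zero] at this
      filter_upwards [this.eventually (gt_mem_nhds hδ)] with w hw
      exact hw.le)
  filter_upwards [hev] with t ht z
  have e2 : iteratedFDeriv ℝ k (fun z => Γ (t, z)) z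
      = iteratedFDeriv ℝ k (fun z => Γ (t, z)) (Int.fract z.1, Int.fract z.2) := by
    have hp : ∀ m : ℤ × ℤ, ∀ z, iteratedFDeriv ℝ k (fun z => Γ (t, z)) (z + ((m.1 : ℝ), (m.2 : ℝ)))
        = iteratedFDeriv ℝ k (fun z => Γ (t, z)) z := by
      intro m z
      rw [← iteratedFDeriv_comp_add_right (f := fun z => Γ (t, z))]
      congr 1
      ext1 z; exact hper t z m
    rw [← hp (-⌊z.1⌋, -⌊z.2⌋) z]
    congr 1
    ext <;> simp [← sub_eq_add_neg]
  rw [e2]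
  exact ht _ ⟨⟨Int.fract_nonneg _, (Int.fract_lt_one _).le⟩, ⟨Int.fract_nonneg _, (Int.fract_lt_one _).le⟩⟩

/-- the conjugated rotation -/
def conj (h : LD) (t : ℝ) (z : ℝ × ℝ) : ℝ × ℝ := h.f ((h.g z).1 + t, (h.g z).2)

lemma conj_smooth (h : LD) (t : ℝ) : ContDiff ℝ (⊤ : ℕ∞) (conj h t) := by
  have h1 := h.cf
  have h2 := h.cg
  unfold conj
  fun_prop

lemma conj_equiv (h : LD) (t : ℝ) : IntEquivariant (conj h t) := by
  intro z m
  unfold conj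
  rw [h.eg, ← h.ef]
  congr 1
  ext <;> simp
  ring

lemma ck_close (h : LD) (t0 : ℝ) (n : ℕ) {δ : ℝ} (hδ : 0 < δ) :
    ∀ᶠ t in 𝓝 t0, ∀ k ≤ n, ∀ z,
      ‖iteratedFDeriv ℝ k (fun z => conj h t z - conj h t0 z) z‖ ≤ δ := by
  have h1 := h.cf
  have h2 := h.cg
  have hall : ∀ k : ℕ, ∀ᶠ t in 𝓝 t0, ∀ z,
      ‖iteratedFDeriv ℝ k (fun z => conj h t z - conj h t0 z) z‖ ≤ δ := by
    intro k
    refine param_close (Γ := fun w => conj h w.1 w.2 - conj h t0 w.2) ?_ ?_ ?_ hδ k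
    · unfold conj; fun_prop
    · intro z; simp
    · intro t z m
      simp [conj_equiv h _ z m]
  have := (Filter.eventually_all_finset (Finset.range (n + 1)) (l := 𝓝 t0)
    (p := fun k t => ∀ z, ‖iteratedFDeriv ℝ k (fun z => conj h t z - conj h t0 z) z‖ ≤ δ)).2
    (fun k _ => hall k)
  filter_upwards [this] with t ht k hk
  exact ht k (Finset.mem_range.2 (by omega))

end AK

namespace AK

lemma norm_coe_le (x : ℝ) : ‖(x : UnitAddCircle)‖ ≤ |x| :=
  QuotientAddGroup.norm_mk_le_norm

lemma proj_lip : LipschitzWith 1 torusProj := by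
  refine LipschitzWith.of_dist_le_mul fun x y => ?_
  rw [NNReal.coe_one, one_mul, Prod.dist_eq, Prod.dist_eq]
  refine max_le_max ?_ ?_
  · rw [dist_eq_norm, Real.dist_eq]
    simp only [torusProj]
    rw [← AddCircle.coe_sub]
    exact norm_coe_le _
  · rw [dist_eq_norm, Real.dist_eq]
    simp only [torusProj]
    rw [← AddCircle.coe_sub]
    exact norm_coe_le _

lemma integral_torus {F : Torus2 → ℝ} (hF : Continuous F) :
    ∫ z, F z = ∫ y in (0:ℝ)..1, ∫ x in (0:ℝ)..1, F (torusProj (x, y)) := by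
  have hhint : Integrable F (volume : Measure Torus2) := by
    refine hF.integrable_of_hasCompactSupport ?_
    exact HasCompactSupport.of_compactSpace _
  rw [Measure.volume_eq_prod] at hhint ⊢
  rw [integral_prod_symm _ hhint]
  rw [← UnitAddCircle.intervalIntegral_preimage 0]
  rw [zero_add]
  refine intervalIntegral.integral_congr fun y _ => ?_
  rw [← UnitAddCircle.intervalIntegral_preimage 0, zero_add]
  rfl

lemma mp_integral {T : Torus2 → Torus2} (hT : MeasurePreserving T volume volume)
    {F : Torus2 → ℝ} (hF : Continuous F) : ∫ z, F (T z) = ∫ z, F z := by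
  conv_rhs => rw [← hT.map_eq]
  rw [integral_map hT.measurable.aemeasurable hF.aestronglyMeasurable]

lemma cont_integrable {F : Torus2 → ℝ} (hF : Continuous F) :
    Integrable F (volume : Measure Torus2) :=
  hF.integrable_of_hasCompactSupport (HasCompactSupport.of_compactSpace _)

lemma LD.descf_cont (A : LD) : Continuous (desc A.f) := desc_continuous A.ef A.cf.continuous
lemma LD.descg_cont (A : LD) : Continuous (desc A.g) := desc_continuous A.eg A.cg.continuous

/-- test function used for non-ergodicity -/
def chi (z : Torus2) : ℝ := ‖z.2‖

lemma chi_cont : Continuous chi := by unfold chi; fun_prop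

lemma chi_sub (z w : Torus2) : |chi z - chi w| ≤ ‖z.2 - w.2‖ := abs_norm_sub_norm_le _ _

/-- displacement of chi -/
def Dsp (A : LD) : ℝ := ∫ z, |chi (desc A.f z) - chi z|

lemma Dsp_comp (A B : LD) : Dsp (A.comp B) ≤ Dsp A + Dsp B := by
  unfold Dsp
  have hA := A.descf_cont
  have hB := B.descf_cont
  have hc := chi_cont
  have e : ∫ z, |chi (desc A.f z) - chi z| = ∫ z, |chi (desc A.f (desc B.f z)) - chi (desc B.f z)| :=
    (mp_integral B.mp (F := fun z => |chi (desc A.f z) - chi z|) (by fun_prop)).symm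
  rw [e, ← integral_add (cont_integrable (by fun_prop)) (cont_integrable (by fun_prop))]
  refine integral_mono (cont_integrable ?_) (cont_integrable (by fun_prop)) ?_
  · have := (A.comp B).descf_cont
    fun_prop
  · intro z
    have : desc (A.comp B).f z = desc A.f (desc B.f z) := by
      change desc (A.f ∘ B.f) z = _
      rw [desc_comp A.ef B.ef]; rfl
    simp only [this]
    exact abs_sub_le _ _ _

lemma Dsp_le (A : LD) {v : ℝ → ℝ} (hv : Continuous v)
    (h : ∀ x y, |chi (torusProj (A.f (x, y))) - chi (torusProj (x, y))| ≤ v x) :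
    Dsp A ≤ ∫ x in (0:ℝ)..1, v x := by
  unfold Dsp
  have hA := A.descf_cont
  have hc := chi_cont
  have hp := proj_continuous
  rw [integral_torus (by fun_prop)]
  have hle : ∀ y, ∫ x in (0:ℝ)..1, |chi (desc A.f (torusProj (x, y))) - chi (torusProj (x, y))|
      ≤ ∫ x in (0:ℝ)..1, v x := by
    intro y
    refine intervalIntegral.integral_mono_on zero_le_one ?_ (hv.intervalIntegrable _ _) ?_
    · exact Continuous.intervalIntegrable (by fun_prop) _ _
    · intro x _
      rw [← desc_proj A.ef]
      exact h x y
  have : ∫ y in (0:ℝ)..1, ∫ x in (0:ℝ)..1, |chi (desc A.f (torusProj (x, y))) - chi (torusProj (x, y))|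
      ≤ ∫ y in (0:ℝ)..1, ∫ x in (0:ℝ)..1, v x := by
    refine intervalIntegral.integral_mono_on zero_le_one ?_ (by simp) (fun y _ => hle y)
    refine Continuous.intervalIntegrable ?_ _ _
    refine intervalIntegral.continuous_parametric_intervalIntegral_of_continuous' ?_ _ _
    fun_prop
  simpa using this

lemma int_scale {v : ℝ → ℝ} (hv : Continuous v) (hp : Function.Periodic v 1) {q : ℕ} (hq : 0 < q) :
    ∫ x in (0:ℝ)..1, v (q * x) = ∫ x in (0:ℝ)..1, v x := by
  have hq' : (q : ℝ) ≠ 0 := by positivity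
  rw [intervalIntegral.integral_comp_mul_left _ hq']
  have := hp.intervalIntegral_add_zsmul_eq q 0 (fun a b => hv.intervalIntegrable a b)
  simp only [zero_add, natCast_zsmul, nsmul_eq_mul, mul_one, smul_eq_mul, mul_zero] at this ⊢
  rw [this]
  field_simp

theorem k_exists {q : ℕ} (hq : 0 < q) {δ : ℝ} (hδ0 : 0 < δ) (hδ : δ ≤ 1) :
    ∃ k : LD, ∃ X Y : ℝ → ℝ, k.f (0, 0) = (0, 0) ∧
      (∀ z : ℝ × ℝ, ∀ i : ℕ, k.f (z.1 + i / q, z.2) = ((k.f z).1 + i / q, (k.f z).2)) ∧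
      (∀ x, k.f (x, 0) = (X x, Y (q * x))) ∧ Continuous Y ∧ Function.Periodic Y 1 ∧
      Dsp k ≤ 2 * δ ∧
      ∀ β : ℝ → ℝ, Continuous β → Function.Periodic β 1 → (∀ y, |β y| ≤ 2) →
      (∫ y in (0:ℝ)..1, β y = 0) → ∀ δ' : ℝ, (∀ y, |y| ≤ δ → |β y| ≤ δ') →
      (∀ σ, 0 ≤ σ → |∫ s in (0:ℝ)..σ, β (Y s)| ≤ (δ' + δ) * σ) ∧
      |∫ s in (0:ℝ)..1, β (Y s)| ≤ δ := by
  obtain ⟨θ, b, ψ, cθ, cb, cψ, pθ, pb, pψ, θ0, b0, ψ0, hθ, hψ, hK⟩ := K_exists hδ0 hδ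
  have hq' : (q : ℝ) ≠ 0 := by positivity
  have sper : ∀ {u : ℝ → ℝ}, Function.Periodic u 1 → Function.Periodic (fun x => u (q * x)) 1 := by
    intro u hu x
    simp only
    rw [show (q : ℝ) * (x + 1) = q * x + q by ring, per_nat hu]
  let V0 := vshear (fun x => θ (q * x)) (by fun_prop) (sper pθ)
  let H := hshear (fun y => b y / q) (by fun_prop) (fun y => by simp [pb y])
  let V := vshear (fun x => ψ (q * x)) (by fun_prop) (sper pψ)
  refine ⟨V.comp (H.comp V0), fun x => x + b (θ (q * x)) / q,
    fun s => θ s + ψ (s + b (θ s)), ?_, ?_, ?_, ?_, ?_, ?_, hK⟩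
  · simp [LD.comp, V0, H, V, vshear, hshear, θ0, b0, ψ0]
  · intro z i
    have e1 : ∀ x : ℝ, q * (x + i / q) = q * x + i := fun x => by field_simp
    have e2 : ∀ x y : ℝ, q * (x + i / q + y / q) = q * (x + y / q) + i := fun x y => by
      field_simp; ring
    simp only [LD.comp, V0, H, V, vshear, hshear, Function.comp, e1, e2, per_nat pθ, per_nat pψ]
    ext <;> simp
    ring
  · intro x
    have e2 : ∀ y : ℝ, q * (x + y / q) = q * x + y := fun y => by
      field_simp
    simp only [LD.comp, V0, H, V, vshear, hshear, Function.comp, zero_add, e2]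
  · have h1 := cθ.continuous
    have h2 := cb.continuous
    have h3 := cψ.continuous
    fun_prop
  · intro s
    simp only
    rw [pθ s, show s + 1 + b (θ s) = (s + b (θ s)) + 1 by ring, pψ]
  · have d0 : Dsp V0 ≤ δ := by
      have := Dsp_le V0 (v := fun _ => δ) continuous_const (by
        intro x y
        refine (chi_sub _ _).trans ?_
        simp only [V0, vshear, torusProj]
        rw [← AddCircle.coe_sub]
        refine (norm_coe_le _).trans ?_
        simpa using hθ _)
      simpa using this
    have d1 : Dsp H ≤ 0 := by
      have := Dsp_le H (v := fun _ => 0) continuous_const (by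
        intro x y
        refine (chi_sub _ _).trans ?_
        simp [H, hshear, torusProj])
      simpa using this
    have d2 : Dsp V ≤ δ := by
      have hv : Continuous (fun x : ℝ => ‖(ψ x : UnitAddCircle)‖) := by
        have h3 := cψ.continuous
        exact ((AddCircle.continuous_mk' (1 : ℝ)).comp h3).norm
      have hvp : Function.Periodic (fun x : ℝ => ‖(ψ x : UnitAddCircle)‖) 1 := by
        intro x; simp only; rw [pψ x]
      refine (Dsp_le V (v := fun x => ‖(ψ (q * x) : UnitAddCircle)‖) (hv.comp (by fun_prop)) ?_).trans ?_
      · intro x y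
        refine (chi_sub _ _).trans ?_
        simp only [V, vshear, torusProj]
        rw [← AddCircle.coe_sub]
        simp
      · rw [int_scale hv hvp hq]
        rw [← intervalIntegral.integral_add_adjacent_intervals (hv.intervalIntegrable 0 δ)
          (hv.intervalIntegrable δ 1)]
        have h1 : |∫ x in (0:ℝ)..δ, ‖(ψ x : UnitAddCircle)‖| ≤ (1/2) * (δ - 0) := by
          refine abs_int_le hδ0.le ?_
          intro x _ _
          have := AddCircle.norm_le_half_period (1:ℝ) (x := (ψ x : UnitAddCircle)) (by norm_num)
          rw [abs_of_nonneg (norm_nonneg _)]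
          simpa using this
        have h2 : ∫ x in δ..1, ‖(ψ x : UnitAddCircle)‖ = 0 := by
          have : ∫ x in δ..1, ‖(ψ x : UnitAddCircle)‖ = ∫ x in δ..1, (0:ℝ) := by
            refine intervalIntegral.integral_congr_ae ?_
            have h1ne : ∀ᵐ x : ℝ, x ≠ 1 := by
              simp [ae_iff]
            filter_upwards [h1ne] with x hx1 hx
            rw [Set.uIoc_of_le hδ] at hx
            have : Int.fract x = x := Int.fract_eq_self.2
              ⟨hδ0.le.trans hx.1.le, lt_of_le_of_ne hx.2 hx1⟩
            rw [hψ x (by rw [this]; exact hx.1.le)]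
            simp
          rw [this]; simp
        rw [h2]
        have := le_abs_self (∫ x in (0:ℝ)..δ, ‖(ψ x : UnitAddCircle)‖)
        linarith
    have := Dsp_comp V (H.comp V0)
    have := Dsp_comp H V0
    linarith

end AK

namespace AK

/-- the class of test functions -/
def TF (f : Torus2 → ℝ) : Prop := LipschitzWith 1 f ∧ ∀ z, |f z| ≤ 1

lemma riemann {u : ℝ → ℝ} {L : NNReal} (hu : LipschitzWith L u) (hp : Function.Periodic u 1)
    {q : ℕ} (hq : 0 < q) (X : ℝ) :
    |∑ r ∈ Finset.range q, u (X + r / q) - q * ∫ x in (0:ℝ)..1, u x| ≤ L := by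
  have hq' : (0 : ℝ) < q := by positivity
  have hc := hu.continuous
  have e1 : ∫ x in (0:ℝ)..1, u x = ∑ r ∈ Finset.range q,
      ∫ x in (X + (r : ℕ) / q)..(X + ((r + 1 : ℕ) : ℝ) / q), u x := by
    rw [intervalIntegral.sum_integral_adjacent_intervals (a := fun r : ℕ => X + (r : ℝ) / q)
      (fun k _ => hc.intervalIntegrable _ _)]
    have := hp.intervalIntegral_add_eq 0 X
    simp only [zero_add] at this
    rw [this]
    simp [hq'.ne']
  rw [e1, Finset.mul_sum, ← Finset.sum_sub_distrib]
  refine (Finset.abs_sum_le_sum_abs _ _).trans ?_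
  have hb : ∀ r ∈ Finset.range q, |u (X + r / q) -
      q * ∫ x in (X + (r : ℕ) / q)..(X + ((r + 1 : ℕ) : ℝ) / q), u x| ≤ L / q := by
    intro r _
    set a := X + (r : ℝ) / q with ha
    have hbq : X + ((r + 1 : ℕ) : ℝ) / q = a + 1 / q := by rw [ha]; push_cast; ring
    rw [hbq]
    have hle : a ≤ a + 1 / q := by have : 0 < 1 / (q:ℝ) := by positivity
                                   linarith
    have h1 : |∫ x in a..(a + 1 / q), (u a - u x)| ≤ (L * (1 / q)) * (a + 1 / q - a) := by
      refine abs_int_le hle fun x h1 h2 => ?_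
      have := hu.dist_le_mul a x
      rw [Real.dist_eq, Real.dist_eq] at this
      refine this.trans ?_
      gcongr
      rw [abs_le]; constructor <;> linarith [hle]
    rw [intervalIntegral.integral_sub (by simp) (hc.intervalIntegrable _ _)] at h1
    simp only [intervalIntegral.integral_const, smul_eq_mul] at h1
    have e2 : u a - q * ∫ x in a..(a + 1 / q), u x =
        q * ((a + 1 / q - a) * u a - ∫ x in a..(a + 1 / q), u x) := by
      field_simp; ring
    rw [e2, abs_mul, abs_of_pos hq']
    calc (q:ℝ) * |(a + 1 / q - a) * u a - ∫ x in a..(a + 1 / q), u x|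
        ≤ q * ((L * (1 / q)) * (a + 1 / q - a)) := by gcongr
      _ = L / q := by field_simp; ring
  refine (Finset.sum_le_sum hb).trans ?_
  simp
  field_simp
  rfl

/-- horizontal average -/
def Bav (h : LD) (f : Torus2 → ℝ) (y : ℝ) : ℝ := ∫ x in (0:ℝ)..1, f (torusProj (h.f (x, y)))

section
variable {h : LD} {L : NNReal} {f : Torus2 → ℝ}

lemma comp_lip (hL : LipschitzWith L h.f) (hf : TF f) :
    LipschitzWith L (fun z => f (torusProj (h.f z))) := by
  have := (hf.1.comp proj_lip).comp hL
  simpa [Function.comp_def] using this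

lemma comp_lip_x (hL : LipschitzWith L h.f) (hf : TF f) (y : ℝ) :
    LipschitzWith L (fun x => f (torusProj (h.f (x, y)))) := by
  have := (comp_lip hL hf).comp (LipschitzWith.prodMk_right y)
  simpa [Function.comp_def] using this

lemma comp_per (h : LD) (f : Torus2 → ℝ) (y : ℝ) :
    Function.Periodic (fun x => f (torusProj (h.f (x, y)))) 1 := by
  intro x
  have := h.ef (x, y) (1, 0)
  simp only [Prod.mk_add_mk, Int.cast_one, Int.cast_zero, add_zero] at this
  have e := proj_add_int (h.f (x, y)) (1, 0)
  simp only [Int.cast_one, Int.cast_zero] at e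
  simp only [this, e]

lemma Bav_lip (hL : LipschitzWith L h.f) (hf : TF f) (y y' : ℝ) :
    |Bav h f y - Bav h f y'| ≤ L * |y - y'| := by
  unfold Bav
  rw [← intervalIntegral.integral_sub ((comp_lip_x hL hf y).continuous.intervalIntegrable _ _)
    ((comp_lip_x hL hf y').continuous.intervalIntegrable _ _)]
  have := abs_int_le (G := fun x => f (torusProj (h.f (x, y))) - f (torusProj (h.f (x, y'))))
    (C := L * |y - y'|) (zero_le_one (α := ℝ)) (by
      intro x _ _
      have := (comp_lip hL hf).dist_le_mul (x, y) (x, y')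
      simp only [Prod.dist_eq, Real.dist_eq, sub_self, abs_zero] at this
      rwa [max_eq_right (abs_nonneg _)] at this)
  simpa using this

lemma Bav_cont (hL : LipschitzWith L h.f) (hf : TF f) : Continuous (Bav h f) := by
  have : LipschitzWith L (Bav h f) := LipschitzWith.of_dist_le_mul fun x y => by
    simpa [Real.dist_eq] using Bav_lip hL hf x y
  exact this.continuous

lemma Bav_le (hf : TF f) (y : ℝ) : |Bav h f y| ≤ 1 := by
  have := abs_int_le (G := fun x => f (torusProj (h.f (x, y))))
    (C := 1) (zero_le_one (α := ℝ)) (fun x _ _ => hf.2 _)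
  simpa [Bav] using this

lemma Bav_per (h : LD) (f : Torus2 → ℝ) : Function.Periodic (Bav h f) 1 := by
  intro y
  unfold Bav
  refine intervalIntegral.integral_congr fun x _ => ?_
  have := h.ef (x, y) (0, 1)
  simp only [Prod.mk_add_mk, Int.cast_one, Int.cast_zero, add_zero] at this
  have e := proj_add_int (h.f (x, y)) (0, 1)
  simp only [Int.cast_one, Int.cast_zero] at e
  simp only [this, e]

lemma Bav_int (hf : TF f) : ∫ y in (0:ℝ)..1, Bav h f y = ∫ z, f z := by
  have hd := h.descf_cont
  have hfc := hf.1.continuous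
  rw [← mp_integral h.mp hfc, integral_torus (by fun_prop)]
  unfold Bav
  simp only [desc_proj h.ef]

lemma int_le_one (hf : TF f) : |∫ z, f z| ≤ 1 := by
  rw [← Bav_int (h := LD.one) hf]
  have := abs_int_le (G := Bav LD.one f)
    (C := 1) (zero_le_one (α := ℝ)) (fun x _ _ => Bav_le hf _)
  simpa using this

theorem step_est (hL : LipschitzWith L h.f) (hf : TF f) {q p : ℕ} (hq : 0 < q)
    (hpq : Nat.Coprime p q) {e δ : ℝ} (he : |Bav h f 0 - ∫ z, f z| ≤ e) (hδ0 : 0 < δ)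
    {k : LD} {X Y : ℝ → ℝ}
    (hcom : ∀ z : ℝ × ℝ, ∀ i : ℕ, k.f (z.1 + i / q, z.2) = ((k.f z).1 + i / q, (k.f z).2))
    (hXY : ∀ x, k.f (x, 0) = (X x, Y (q * x))) (hY : Continuous Y) (hYp : Function.Periodic Y 1)
    (hhint : ∀ β : ℝ → ℝ, Continuous β → Function.Periodic β 1 → (∀ y, |β y| ≤ 2) →
      (∫ y in (0:ℝ)..1, β y = 0) → ∀ δ' : ℝ, (∀ y, |y| ≤ δ → |β y| ≤ δ') →
      (∀ σ, 0 ≤ σ → |∫ s in (0:ℝ)..σ, β (Y s)| ≤ (δ' + δ) * σ) ∧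
      |∫ s in (0:ℝ)..1, β (Y s)| ≤ δ) :
    |Bav (h.comp k) f 0 - ∫ z, f z| ≤ L / q + δ ∧
    ∀ L' : NNReal, LipschitzWith L' (h.comp k).f → ∀ ε : ℝ, 0 < ε → ∀ N : ℕ,
      |∑ j ∈ Finset.range N, f (torusProj ((h.comp k).f (j * (p / q + ε), 0))) - N * ∫ z, f z|
        ≤ N * (L / q + (e + L * δ + δ) + L' * (q * ε)) + 2 * q := by
  have hq' : (0 : ℝ) < q := by positivity
  set c := ∫ z, f z with hc
  set B := Bav h f with hB
  have hBc : Continuous B := Bav_cont hL hf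
  set Φ : ℝ → ℝ := fun x => f (torusProj ((h.comp k).f (x, 0))) with hΦ
  set G : ℝ → ℝ := fun x => B (Y (q * x)) with hG
  have hGc : Continuous G := by fun_prop
  have hΦc : Continuous Φ := by
    obtain ⟨M, hM⟩ := (h.comp k).lip
    exact (comp_lip_x hM hf 0).continuous
  have hκ : ∀ x, |∑ r ∈ Finset.range q, Φ (x + r / q) - q * G x| ≤ q * (L / q) := by
    intro x
    have := riemann (comp_lip_x hL hf (Y (q * x))) (comp_per h f (Y (q * x))) hq (X x)
    have e : ∀ r : ℕ, Φ (x + r / q) = f (torusProj (h.f (X x + r / q, Y (q * x)))) := by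
      intro r
      have := hcom (x, 0) r
      simp only [hXY x] at this
      simp only [hΦ, LD.comp, Function.comp, this]
    simp only [e]
    rw [mul_div_cancel₀ _ hq'.ne']
    exact this
  have hΦp : Function.Periodic Φ 1 := comp_per _ f 0
  have hβ := hhint (fun y => B y - c) (by fun_prop) (fun y => by simp only [hB, Bav_per h f y])
    (fun y => (abs_sub _ _).trans (by linarith [Bav_le (h := h) hf y, int_le_one hf]))
    (by
      rw [intervalIntegral.integral_sub (hBc.intervalIntegrable _ _) (by simp)]
      simp [hB, Bav_int hf, hc]) (e + L * δ) (by
      intro y hy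
      have h1 := Bav_lip hL hf y 0
      rw [sub_zero] at h1
      have h2 : (L:ℝ) * |y| ≤ L * δ := by gcongr
      have : B y - c = (B y - B 0) + (B 0 - c) := by ring
      rw [this]
      refine (abs_add_le _ _).trans ?_
      linarith)
  have he0 : 0 ≤ e := (abs_nonneg _).trans he
  constructor
  · have hI : ∀ r : ℕ, ∫ x in (0:ℝ)..1, Φ (x + r / q) = ∫ x in (0:ℝ)..1, Φ x := by
      intro r
      rw [intervalIntegral.integral_comp_add_right Φ]
      have := hΦp.intervalIntegral_add_eq 0 ((r:ℝ) / q)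
      rw [zero_add] at this ⊢
      rw [this, add_comm (1:ℝ)]
    have h1 := abs_int_le (G := fun x => ∑ r ∈ Finset.range q, Φ (x + r / q) - q * G x)
      (zero_le_one (α := ℝ)) (fun x _ _ => hκ x)
    rw [intervalIntegral.integral_sub (Continuous.intervalIntegrable (by fun_prop) _ _)
      (Continuous.intervalIntegrable (by fun_prop) _ _),
      intervalIntegral.integral_finsetSum
        (fun r _ => Continuous.intervalIntegrable (by fun_prop) _ _)] at h1
    simp only [hI, Finset.sum_const, Finset.card_range, nsmul_eq_mul,
      intervalIntegral.integral_const_mul] at h1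
    rw [← mul_sub, abs_mul, abs_of_pos hq', sub_zero, mul_one] at h1
    have h2 := le_of_mul_le_mul_left h1 hq'
    have h3 : ∫ x in (0:ℝ)..1, G x = ∫ s in (0:ℝ)..1, B (Y s) :=
      int_scale (v := fun s => B (Y s)) (by fun_prop) (fun s => by simp only [hYp s]) hq
    have h4 := hβ.2
    rw [intervalIntegral.integral_sub (Continuous.intervalIntegrable (by fun_prop) _ _) (by simp)] at h4
    simp only [intervalIntegral.integral_const, sub_zero, one_smul] at h4
    have h5 : Bav (h.comp k) f 0 - c = ((∫ x in (0:ℝ)..1, Φ x) - ∫ x in (0:ℝ)..1, G x)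
        + ((∫ s in (0:ℝ)..1, B (Y s)) - c) := by
      rw [h3]
      simp only [Bav, hΦ]; ring
    rw [h5]
    refine (abs_add_le _ _).trans ?_
    rw [← h3] at h4 ⊢
    exact add_le_add h2 h4
  · intro L' hL' ε hε N
    refine drift hGc hΦp (comp_lip_x hL' hf 0) (fun x => hf.2 _) hq hpq hε hκ (by positivity)
      (by positivity) (int_le_one hf) ?_ N
    intro σ hσ
    have h1 := hβ.1 (q * σ) (by positivity)
    have h2 : ∫ x in (0:ℝ)..σ, (G x - c) = (q:ℝ)⁻¹ * ∫ s in (0:ℝ)..(q * σ), (B (Y s) - c) := by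
      have := intervalIntegral.integral_comp_mul_left (a := 0) (b := σ)
        (fun s => B (Y s) - c) hq'.ne'
      simpa [hG] using this
    rw [h2, abs_mul, abs_of_pos (by positivity)]
    calc (q:ℝ)⁻¹ * |∫ s in (0:ℝ)..(q * σ), (B (Y s) - c)|
        ≤ (q:ℝ)⁻¹ * ((e + L * δ + δ) * (q * σ)) := by gcongr
      _ = _ := by field_simp

end

end AK

namespace AK

/-- stage of the construction -/
structure St where
  h : LD
  p : ℕ
  q : ℕ
  hq : 0 < q
  hpq : Nat.Coprime p q

/-- rotation number of a stage -/
def St.a (s : St) : ℝ := s.p / s.q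

/-- inductive hypothesis -/
structure Inv (n : ℕ) (s : St) : Prop where
  E : ∀ f, TF f → |Bav s.h f 0 - ∫ z, f z| ≤ 2 * (1/2)^n
  Q : ∃ L : NNReal, LipschitzWith L s.h.f ∧ (L:ℝ) ≤ (1/2)^n / 4 * s.q
  Z : s.h.f (0, 0) = (0, 0)

/-- relation between successive stages -/
structure StepR (n : ℕ) (s s' : St) : Prop where
  a : ∫ z, |chi (desc s'.h.g z) - chi (desc s.h.g z)| ≤ (1/100) * (1/2)^n
  b : ∀ k ≤ n, ∀ z, ‖iteratedFDeriv ℝ k (fun z => conj s'.h s'.a z - conj s.h s.a z) z‖ ≤ (1/2)^n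
  b' : ∀ k ≤ n, ∀ z,
    ‖iteratedFDeriv ℝ k (fun z => conj s'.h (-s'.a) z - conj s.h (-s.a) z) z‖ ≤ (1/2)^n
  c : ∀ j : ℕ, j ≤ (n + 1) * s.q → dist (s'.h.f (j * s'.a, 0)) (s.h.f (j * s.a, 0)) ≤ (1/2)^n
  d : ∀ N : ℕ, ∀ f, TF f →
    |∑ j ∈ Finset.range N, f (torusProj (s'.h.f (j * s'.a, 0))) - N * ∫ z, f z|
      ≤ 5 * N * (1/2)^n + 2 * s.q
  e : s.q ≤ s'.q

lemma inv_zero : ∃ s, Inv 0 s := by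
  refine ⟨⟨LD.one, 1, 4, by norm_num, by norm_num⟩, ?_, ?_, ?_⟩
  · intro f hf
    refine (abs_sub _ _).trans ?_
    have := Bav_le (h := LD.one) hf 0
    have := int_le_one hf
    simp only [pow_zero]
    linarith
  · exact ⟨1, LipschitzWith.id, by norm_num⟩
  · rfl

lemma a_eq (h k : LD) : ∫ z, |chi (desc (h.comp k).g z) - chi (desc h.g z)| = Dsp k := by
  have hc := chi_cont
  have h1 := h.descg_cont
  have h2 := k.descg_cont
  have h3 := k.descf_cont
  have e1 : ∀ z, desc (h.comp k).g z = desc k.g (desc h.g z) := fun z => by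
    change desc (k.g ∘ h.g) z = _
    rw [desc_comp k.eg h.eg]; rfl
  simp only [e1]
  rw [mp_integral h.inv_mp (F := fun z => |chi (desc k.g z) - chi z|) (by fun_prop),
    ← mp_integral k.mp (by fun_prop)]
  unfold Dsp
  have e2 : ∀ z, desc k.g (desc k.f z) = z := fun z => by
    have : desc k.g ∘ desc k.f = id := by
      rw [← desc_comp k.eg k.ef, ← desc_id]; congr 1; ext1 p; exact k.gf p
    exact congrFun this z
  simp only [e2]
  simp only [abs_sub_comm]

theorem step_exists (n : ℕ) (s : St) (hs : Inv n s) : ∃ s', Inv (n + 1) s' ∧ StepR n s s' := by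
  obtain ⟨h, p, q, hq, hpq⟩ := s
  obtain ⟨hE, ⟨L, hL, hLq⟩, hZ⟩ := hs
  simp only at hE hL hLq hZ
  have hq' : (0 : ℝ) < q := by positivity
  set e : ℝ := (1/2)^n with he
  have he0 : 0 < e := by positivity
  have he1 : e ≤ 1 := pow_le_one₀ (by norm_num) (by norm_num)
  set δ : ℝ := e / (200 * (1 + L)) with hδ
  have hL0 : (0:ℝ) ≤ L := L.2
  have hδ0 : 0 < δ := by positivity
  have hδe : δ * (200 * (1 + L)) = e := by rw [hδ]; field_simp
  have hδL : 0 ≤ δ * L := by positivity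
  obtain ⟨k, X, Y, hk0, hcom, hXY, hY, hYp, hD, hhint⟩ := k_exists hq hδ0 (by nlinarith)
  obtain ⟨L', hL'⟩ := (h.comp k).lip
  have hest := fun f hf => step_est hL hf hq hpq (hE f hf) hδ0 hcom hXY hY hYp hhint
  have hcom' : ∀ z : ℝ × ℝ, ∀ i : ℕ, k.f (z.1 + -(i / q), z.2) = ((k.f z).1 + -(i / q), (k.f z).2) := by
    intro z i
    have := hcom (z.1 + -(i / q), z.2) i
    simp only [neg_add_cancel_right] at this
    rw [this]
    simp
  -- conjugates agree at the old angle
  have hconj : conj (h.comp k) (p / q) = conj h (p / q) := by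
    funext z
    simp only [conj, LD.comp, Function.comp]
    rw [hcom, k.fg]
  have hconj' : conj (h.comp k) (-(p / q)) = conj h (-(p / q)) := by
    funext z
    simp only [conj, LD.comp, Function.comp]
    rw [hcom', k.fg]
  -- choose m
  have hlim : Tendsto (fun m : ℕ => 1 / ((m : ℝ) * q ^ 2)) atTop (𝓝 0) := by
    have := (tendsto_one_div_atTop_nhds_zero_nat (𝕜 := ℝ)).mul_const (1 / (q:ℝ)^2)
    rw [zero_mul] at this
    refine this.congr fun m => ?_
    rw [div_mul_div_comm, one_mul]
  have hlim1 : Tendsto (fun m : ℕ => (p:ℝ) / q + 1 / ((m : ℝ) * q ^ 2)) atTop (𝓝 ((p:ℝ) / q)) := by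
    simpa using hlim.const_add ((p:ℝ) / q)
  have hlim2 : Tendsto (fun m : ℕ => -((p:ℝ) / q + 1 / ((m : ℝ) * q ^ 2))) atTop (𝓝 (-((p:ℝ) / q))) :=
    hlim1.neg
  have ev1 := hlim1.eventually (ck_close (h.comp k) (p / q) n he0)
  have ev2 := hlim2.eventually (ck_close (h.comp k) (-(p / q)) n he0)
  have ev3 : ∀ᶠ m : ℕ in atTop, (L' * ((n + 1) * q)) * (1 / ((m : ℝ) * q ^ 2)) < e := by
    have := hlim.const_mul ((L':ℝ) * ((n + 1) * q))
    rw [mul_zero] at this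
    exact this.eventually_lt_const he0
  have ev4 : ∀ᶠ m : ℕ in atTop, 8 * (L':ℝ) / e ≤ m :=
    tendsto_natCast_atTop_atTop.eventually_ge_atTop _
  obtain ⟨m, h1, h2, h3, h4, h5⟩ :=
    (ev1.and (ev2.and (ev3.and (ev4.and (eventually_ge_atTop 1))))).exists
  have hm : (0:ℝ) < m := by exact_mod_cast h5
  set ε : ℝ := 1 / ((m : ℝ) * q ^ 2) with hε
  have hε0 : 0 < ε := by positivity
  have hcop : Nat.Coprime (m * p * q + 1) (m * q ^ 2) := by
    refine Nat.Coprime.mul_right ?_ (Nat.Coprime.pow_right 2 ?_)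
    · rw [mul_assoc]; simp
    · simp
  have hq1 : (1:ℝ) ≤ q := by exact_mod_cast hq
  have ha : (((m * p * q + 1 : ℕ) : ℝ)) / ((m * q ^ 2 : ℕ) : ℝ) = p / q + ε := by
    rw [hε]; push_cast; field_simp
  have hL'0 : (0:ℝ) ≤ L' := L'.2
  refine ⟨⟨h.comp k, m * p * q + 1, m * q ^ 2, by positivity, hcop⟩, ⟨?_, ?_, ?_⟩,
    ⟨?_, ?_, ?_, ?_, ?_, ?_⟩⟩
  · intro f hf
    refine (hest f hf).1.trans ?_
    have : (L:ℝ) / q ≤ e / 4 := by rw [div_le_iff₀ hq']; exact hLq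
    rw [pow_succ, ← he]
    nlinarith
  · refine ⟨L', hL', ?_⟩
    simp only
    rw [div_le_iff₀ he0] at h4
    push_cast
    rw [pow_succ, ← he]
    have : (m:ℝ) * e ≤ m * e * q ^ 2 := by
      have : 1 ≤ (q:ℝ)^2 := one_le_pow₀ hq1
      nlinarith [mul_pos hm he0]
    nlinarith
  · simp [LD.comp, hk0, hZ]
  · simp only
    rw [a_eq]
    refine hD.trans ?_
    nlinarith
  · simp only [St.a, ha]
    rw [← hconj]
    exact h1
  · simp only [St.a, ha]
    rw [← hconj']
    exact h2
  · intro j hj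
    simp only [St.a, ha] at hj ⊢
    have e0 : h.f (j * (p / q), 0) = (h.comp k).f (j * (p / q), 0) := by
      have := hcom (0, 0) (j * p)
      simp only [hk0, zero_add] at this
      simp only [LD.comp, Function.comp]
      rw [show (j:ℝ) * (p / q) = ((j * p : ℕ) : ℝ) / q by push_cast; ring, this]
    rw [e0]
    refine (hL'.dist_le_mul _ _).trans ?_
    have : dist (((j:ℝ) * (p / q + ε), (0:ℝ))) ((j:ℝ) * (p / q), (0:ℝ)) = j * ε := by
      rw [Prod.dist_eq, dist_self, Real.dist_eq, max_eq_left (abs_nonneg _),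
        show (j:ℝ) * (p / q + ε) - j * (p / q) = j * ε by ring, abs_of_nonneg (by positivity)]
    rw [this]
    have hj' : (j:ℝ) ≤ (n + 1) * q := by exact_mod_cast hj
    refine le_trans ?_ h3.le
    rw [mul_assoc]
    gcongr
  · intro N f hf
    simp only [St.a, ha]
    refine ((hest f hf).2 L' hL' ε hε0 N).trans ?_
    have i1 : (L:ℝ) / q ≤ e / 4 := by rw [div_le_iff₀ hq']; exact hLq
    have i2 : (L':ℝ) * (q * ε) ≤ e := by
      refine le_trans ?_ h3.le
      rw [mul_assoc]
      gcongr
      nlinarith [mul_pos hq' hε0, mul_nonneg (Nat.cast_nonneg (α := ℝ) n) (mul_pos hq' hε0).le]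
    have i3 : (L:ℝ) / q + (2 * e + L * δ + δ) + L' * (q * ε) ≤ 5 * e := by nlinarith
    have : (N:ℝ) * (L / q + (2 * e + L * δ + δ) + L' * (q * ε)) ≤ N * (5 * e) := by gcongr
    linarith
  · simp only
    have : q ≤ q ^ 2 := Nat.le_self_pow (by norm_num) q
    nlinarith

/-- the sequence of stages -/
theorem seq_exists : ∃ s : ℕ → St, ∀ n, Inv n (s n) ∧ StepR n (s n) (s (n + 1)) := by
  obtain ⟨s0, h0⟩ := inv_zero
  choose F hF1 hF2 using step_exists
  let t : (n : ℕ) → {s : St // Inv n s} := fun n =>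
    Nat.rec (motive := fun n => {s : St // Inv n s}) ⟨s0, h0⟩ (fun n s => ⟨F n s.1 s.2, hF1 n s.1 s.2⟩) n
  exact ⟨fun n => (t n).1, fun n => ⟨(t n).2, hF2 n (t n).1 (t n).2⟩⟩

end AK

namespace AK

lemma half_tendsto : Tendsto (fun n : ℕ => 2 * (1/2 : ℝ)^n) atTop (𝓝 0) := by
  have := (tendsto_pow_atTop_nhds_zero_of_lt_one (r := (1/2:ℝ)) (by norm_num)
    (by norm_num)).const_mul 2
  simpa using this

theorem lim_exists {F : ℕ → ℝ × ℝ → ℝ × ℝ} (hc : ∀ n, ContDiff ℝ (⊤ : ℕ∞) (F n))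
    (he : ∀ n, IntEquivariant (F n))
    (hb : ∀ n, ∀ k ≤ n, ∀ z, ‖iteratedFDeriv ℝ k (fun z => F (n + 1) z - F n z) z‖ ≤ (1/2)^n) :
    ∃ T : ℝ × ℝ → ℝ × ℝ, ContDiff ℝ (⊤ : ℕ∞) T ∧ IntEquivariant T ∧
      ∀ n z, dist (F n z) (T z) ≤ 2 * (1/2)^n := by
  have hb0 : ∀ n z, dist (F n z) (F (n + 1) z) ≤ (1/2)^n := by
    intro n z
    have := hb n 0 (Nat.zero_le n) z
    rw [norm_iteratedFDeriv_zero] at this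
    rwa [dist_comm, dist_eq_norm]
  have hsum : Summable (fun n : ℕ => (1/2 : ℝ)^n) := summable_geometric_two
  let T : ℝ × ℝ → ℝ × ℝ := fun z => F 0 z + ∑' n, (F (n + 1) z - F n z)
  have hT : ∀ z, Tendsto (fun n => F n z) atTop (𝓝 (T z)) := by
    intro z
    have hs : Summable (fun n => F (n + 1) z - F n z) := by
      refine Summable.of_norm_bounded hsum fun n => ?_
      have := hb0 n z
      rwa [dist_comm, dist_eq_norm] at this
    have := (hs.hasSum.tendsto_sum_nat).const_add (F 0 z)
    refine this.congr fun n => ?_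
    rw [Finset.sum_range_sub (fun n => F n z)]
    abel
  refine ⟨T, ?_, ?_, ?_⟩
  · refine (hc 0).add ?_
    refine contDiff_tsum_of_eventually (v := fun _ n => (1/2 : ℝ)^n)
      (fun i => (hc (i + 1)).sub (hc i)) (fun _ _ => hsum) ?_
    intro k _
    rw [Nat.cofinite_eq_atTop]
    filter_upwards [eventually_ge_atTop k] with n hn z
    exact hb n k hn z
  · intro p m
    refine tendsto_nhds_unique (hT _) ?_
    refine ((hT p).add_const _).congr fun n => ?_
    rw [he n]
  · intro n z
    have := dist_le_of_le_geometric_two_of_tendsto (C := 2) (f := fun n => F n z) (a := T z)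
      (fun n => by
        refine (hb0 n z).trans (le_of_eq ?_)
        rw [one_div, inv_pow]; ring) (hT z) n
    refine this.trans (le_of_eq ?_)
    rw [one_div, inv_pow]; ring

lemma lim_apply {F : ℕ → ℝ × ℝ → ℝ × ℝ} {T : ℝ × ℝ → ℝ × ℝ} (hT : Continuous T)
    (h : ∀ n z, dist (F n z) (T z) ≤ 2 * (1/2)^n) {w : ℕ → ℝ × ℝ} {w0 : ℝ × ℝ}
    (hw : Tendsto w atTop (𝓝 w0)) : Tendsto (fun n => F n (w n)) atTop (𝓝 (T w0)) := by
  have h1 : Tendsto (fun n => T (w n)) atTop (𝓝 (T w0)) := (hT.tendsto _).comp hw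
  refine (tendsto_iff_of_dist ?_).2 h1
  exact squeeze_zero (fun _ => dist_nonneg) (fun n => h n (w n)) half_tendsto

lemma lim_self {F : ℕ → ℝ × ℝ → ℝ × ℝ} {T : ℝ × ℝ → ℝ × ℝ}
    (h : ∀ n z, dist (F n z) (T z) ≤ 2 * (1/2)^n) (z : ℝ × ℝ) :
    Tendsto (fun n => F n z) atTop (𝓝 (T z)) := by
  rw [tendsto_iff_dist_tendsto_zero]
  exact squeeze_zero (fun _ => dist_nonneg) (fun n => h n z) half_tendsto

lemma lim_iter {F : ℕ → ℝ × ℝ → ℝ × ℝ} {T : ℝ × ℝ → ℝ × ℝ} (hT : Continuous T)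
    (h : ∀ n z, dist (F n z) (T z) ≤ 2 * (1/2)^n) (z : ℝ × ℝ) (j : ℕ) :
    Tendsto (fun n => (F n)^[j] z) atTop (𝓝 (T^[j] z)) := by
  induction j with
  | zero => exact tendsto_const_nhds
  | succ j ih =>
    simp only [Function.iterate_succ_apply']
    exact lim_apply hT h ih

lemma desc_dist {F T : ℝ × ℝ → ℝ × ℝ} (hF : IntEquivariant F) (hT : IntEquivariant T) {d : ℝ}
    (h : ∀ z, dist (F z) (T z) ≤ d) (z : Torus2) : dist (desc F z) (desc T z) ≤ d := by
  obtain ⟨p, rfl⟩ := proj_surj z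
  rw [← desc_proj hF, ← desc_proj hT]
  have := proj_lip.dist_le_mul (F p) (T p)
  rw [NNReal.coe_one, one_mul] at this
  exact this.trans (h p)

lemma lim_mp {F : ℕ → ℝ × ℝ → ℝ × ℝ} {T : ℝ × ℝ → ℝ × ℝ} (hT : Continuous T)
    (hF : ∀ n, Continuous (F n)) (eF : ∀ n, IntEquivariant (F n)) (eT : IntEquivariant T)
    (h : ∀ n z, dist (F n z) (T z) ≤ 2 * (1/2)^n)
    (hm : ∀ n, MeasurePreserving (desc (F n)) (volume : Measure Torus2) volume) :
    MeasurePreserving (desc T) (volume : Measure Torus2) volume := by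
  have hdT := desc_continuous eT hT
  refine ⟨hdT.measurable, ?_⟩
  have : IsFiniteMeasure (Measure.map (desc T) (volume : Measure Torus2)) :=
    Measure.isFiniteMeasure_map _ _
  refine ext_of_forall_integral_eq_of_IsFiniteMeasure fun f => ?_
  rw [integral_map hdT.measurable.aemeasurable f.continuous.aestronglyMeasurable]
  have hlim : Tendsto (fun n => ∫ z, f (desc (F n) z)) atTop (𝓝 (∫ z, f (desc T z))) := by
    refine tendsto_integral_of_dominated_convergence (fun _ => ‖f‖) ?_ (integrable_const _) ?_ ?_
    · intro n
      exact (f.continuous.comp (desc_continuous (eF n) (hF n))).aestronglyMeasurable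
    · intro n
      exact Eventually.of_forall fun z => f.norm_coe_le_norm _
    · refine Eventually.of_forall fun z => (f.continuous.tendsto _).comp ?_
      rw [tendsto_iff_dist_tendsto_zero]
      exact squeeze_zero (fun _ => dist_nonneg)
        (fun n => desc_dist (eF n) eT (h n) z) half_tendsto
  have hconst : ∀ n, ∫ z, f (desc (F n) z) = ∫ z, f z := fun n => mp_integral (hm n) f.continuous
  simp only [hconst] at hlim
  exact tendsto_nhds_unique hlim tendsto_const_nhds

lemma conj_mp (h : LD) (t : ℝ) :
    MeasurePreserving (desc (conj h t)) (volume : Measure Torus2) volume := by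
  have e : conj h t = h.f ∘ ((tr t).f ∘ h.g) := by
    funext z; simp [conj]
  rw [e, desc_comp h.ef (equiv_comp (tr t).ef h.eg), desc_comp (tr t).ef h.eg]
  exact h.mp.comp ((tr t).mp.comp h.inv_mp)

lemma conj_inv (h : LD) (t : ℝ) (z : ℝ × ℝ) : conj h t (conj h (-t) z) = z := by
  simp [conj, h.gf, h.fg]

lemma conj_iter (h : LD) (t : ℝ) (z : ℝ × ℝ) (j : ℕ) :
    (conj h t)^[j] (h.f z) = h.f (z.1 + j * t, z.2) := by
  induction j with
  | zero => simp
  | succ j ih =>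
    rw [Function.iterate_succ_apply', ih]
    simp only [conj, h.gf]
    push_cast
    congr 2
    ring

lemma chi_inv (h : LD) (t : ℝ) (z : Torus2) :
    chi (desc h.g (desc (conj h t) z)) = chi (desc h.g z) := by
  obtain ⟨p, rfl⟩ := proj_surj z
  rw [← desc_proj (conj_equiv h t), ← desc_proj h.eg, ← desc_proj h.eg]
  simp [chi, torusProj, conj, h.gf]

lemma chi_nonconst (c : ℝ) : 1/16 ≤ ∫ z, |chi z - c| := by
  have hc := chi_cont
  have hp := proj_continuous
  rw [integral_torus (by fun_prop)]
  have e1 : ∀ y : ℝ, ∫ x in (0:ℝ)..1, |chi (torusProj (x, y)) - c| = |‖(y : UnitAddCircle)‖ - c| := by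
    intro y
    simp [chi, torusProj]
  simp only [e1]
  have hcc : Continuous (fun y : ℝ => |‖(y : UnitAddCircle)‖ - c|) := by
    have := (AddCircle.continuous_mk' (1 : ℝ)).norm
    exact (this.sub continuous_const).abs
  have hn : ∀ y : ℝ, 0 ≤ y → y ≤ 1/2 → ‖(y : UnitAddCircle)‖ = y := by
    intro y h0 h1
    rw [(AddCircle.norm_coe_eq_abs_iff (1:ℝ) (by norm_num)).2, abs_of_nonneg h0]
    rw [abs_of_nonneg h0]; simpa using h1
  set w := fun y : ℝ => |‖(y : UnitAddCircle)‖ - c| with hw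
  have i1 := intervalIntegral.integral_add_adjacent_intervals
    (hcc.intervalIntegrable (μ := volume) 0 (1/4)) (hcc.intervalIntegrable (1/4) (1/2))
  have i2 := intervalIntegral.integral_add_adjacent_intervals
    (hcc.intervalIntegrable (μ := volume) 0 (1/2)) (hcc.intervalIntegrable (1/2) 1)
  have i3 : 0 ≤ ∫ y in (1/2:ℝ)..1, w y :=
    intervalIntegral.integral_nonneg (by norm_num) fun y _ => abs_nonneg _
  have i4 : ∫ y in (1/4:ℝ)..(1/2), w y = ∫ y in (0:ℝ)..(1/4), w (y + 1/4) := by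
    rw [intervalIntegral.integral_comp_add_right w]
    norm_num
  have i5 : (∫ y in (0:ℝ)..(1/4), (1/4 : ℝ)) ≤ ∫ y in (0:ℝ)..(1/4), (w y + w (y + 1/4)) := by
    refine intervalIntegral.integral_mono_on (by norm_num) (by simp)
      (Continuous.intervalIntegrable (by fun_prop) _ _) ?_
    intro y hy
    simp only [hw]
    rw [hn y hy.1 (by linarith [hy.2]), hn (y + 1/4) (by linarith [hy.1]) (by linarith [hy.2])]
    have h1 := neg_abs_le (y - c)
    have h2 := le_abs_self (y + 1/4 - c)
    linarith
  rw [intervalIntegral.integral_add (hcc.intervalIntegrable _ _)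
    (Continuous.intervalIntegrable (by fun_prop) _ _)] at i5
  simp at i5
  simp only [one_div] at *
  linarith

lemma lip_dense (f : C(Torus2, ℝ)) {ε : ℝ} (hε : 0 < ε) :
    ∃ g : Torus2 → ℝ, ∃ A : ℝ, TF g ∧ ∀ z, |f z - A * g z| ≤ ε := by
  obtain ⟨δ, hδ, hu⟩ := Metric.uniformContinuous_iff.1
    (CompactSpace.uniformContinuous_of_continuous f.continuous) ε hε
  set C := ‖f‖ with hC
  have hC0 : 0 ≤ C := norm_nonneg _
  have hb : ∀ z, |f z| ≤ C := fun z => f.norm_coe_le_norm z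
  let K : NNReal := ⟨2 * C / δ, by positivity⟩
  have hK : (K : ℝ) = 2 * C / δ := rfl
  have hbd : ∀ x, BddBelow (Set.range fun y => f y + K * dist x y) := by
    intro x
    refine ⟨-C, ?_⟩
    rintro _ ⟨y, rfl⟩
    have := neg_abs_le (f y)
    have := hb y
    have : 0 ≤ K * dist x y := by positivity
    simp only
    linarith
  let g : Torus2 → ℝ := fun x => ⨅ y, (f y + K * dist x y)
  have g_le : ∀ x, g x ≤ f x := by
    intro x
    have := ciInf_le (hbd x) x
    simpa using this
  have g_ge : ∀ x, -C ≤ g x := by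
    intro x
    refine le_ciInf fun y => ?_
    have := neg_abs_le (f y)
    have := hb y
    have : 0 ≤ K * dist x y := by positivity
    linarith
  have g_ge' : ∀ x, f x - ε ≤ g x := by
    intro x
    refine le_ciInf fun y => ?_
    by_cases hxy : dist x y < δ
    · have := hu hxy
      rw [Real.dist_eq] at this
      have := le_abs_self (f x - f y)
      have : 0 ≤ K * dist x y := by positivity
      linarith
    · push Not at hxy
      have : 2 * C ≤ K * dist x y := by
        rw [hK, div_mul_eq_mul_div, le_div_iff₀ hδ]
        gcongr
      have := neg_abs_le (f y)
      have := hb y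
      have := le_abs_self (f x)
      have := hb x
      linarith
  have g_lip : LipschitzWith K g := by
    refine LipschitzWith.of_le_add_mul K fun x x' => ?_
    have : g x - K * dist x x' ≤ g x' := by
      refine le_ciInf fun y => ?_
      have h1 := ciInf_le (hbd x) y
      have h2 : (K:ℝ) * dist x y ≤ K * (dist x x' + dist x' y) := by
        gcongr; exact dist_triangle _ _ _
      change g x ≤ _ at h1
      linarith
    linarith
  have hA : (0:ℝ) < K + C + 1 := by positivity
  refine ⟨fun z => (K + C + 1 : ℝ)⁻¹ * g z, K + C + 1, ⟨?_, ?_⟩, ?_⟩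
  · refine LipschitzWith.of_dist_le_mul fun x y => ?_
    have h1 := g_lip.dist_le_mul x y
    rw [Real.dist_eq] at h1
    rw [Real.dist_eq, ← mul_sub, abs_mul, abs_of_pos (by positivity), NNReal.coe_one,
      inv_mul_le_iff₀ hA]
    refine h1.trans ?_
    rw [one_mul]
    gcongr
    linarith
  · intro z
    rw [abs_mul, abs_of_pos (by positivity), inv_mul_le_iff₀ hA]
    have : |g z| ≤ C := abs_le.2 ⟨g_ge z, (g_le z).trans ((le_abs_self _).trans (hb z))⟩
    have : (0:ℝ) ≤ K := K.2
    linarith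
  · intro z
    simp only
    rw [mul_inv_cancel_left₀ hA.ne', abs_le]
    constructor <;> linarith [g_le z, g_ge' z]

end AK

namespace AK

lemma vol_prob : IsProbabilityMeasure (volume : Measure Torus2) := by
  have h : IsProbabilityMeasure (volume : Measure UnitAddCircle) :=
    ⟨by simp⟩
  rw [Measure.volume_eq_prod]; infer_instance


lemma q_mono {s : ℕ → St} (hs : ∀ n, Inv n (s n) ∧ StepR n (s n) (s (n + 1))) : Monotone (fun n => (s n).q) := monotone_nat_of_le_succ fun n => (hs n).2.e

lemma orbit_close {s : ℕ → St} (hs : ∀ n, Inv n (s n) ∧ StepR n (s n) (s (n + 1)))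
    {T : ℝ × ℝ → ℝ × ℝ} (hT : Continuous T)
    (hd : ∀ n z, dist (conj (s n).h (s n).a z) (T z) ≤ 2 * (1/2)^n)
    (n j : ℕ) (hj : j ≤ (n + 1) * (s n).q) :
    dist ((s n).h.f (j * (s n).a, 0)) (T^[j] (0, 0)) ≤ 2 * (1/2)^n := by
  have horb : ∀ m, (conj (s m).h (s m).a)^[j] (0, 0) = (s m).h.f (j * (s m).a, 0) := by
    intro m
    have := conj_iter (s m).h (s m).a (0, 0) j
    rwa [(hs m).1.Z, zero_add] at this
  have hlim := lim_iter hT hd (0, 0) j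
  simp only [horb] at hlim
  have hlim' := hlim.comp (tendsto_add_atTop_nat n)
  have := dist_le_of_le_geometric_two_of_tendsto₀ (C := 2 * (1/2)^n)
    (f := (fun m => (s m).h.f (j * (s m).a, 0)) ∘ (fun i => i + n)) (fun i => ?_) hlim'
  · simpa using this
  · simp only [Function.comp]
    rw [dist_comm, show i + 1 + n = i + n + 1 by ring]
    have hq : (s n).q ≤ (s (i + n)).q := q_mono hs (by omega)
    refine ((hs (i + n)).2.c j (hj.trans ?_)).trans (le_of_eq ?_)
    · exact Nat.mul_le_mul (by omega) hq
    · rw [pow_add, mul_div_cancel_left₀ _ (two_ne_zero), one_div, inv_pow, inv_pow]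
      field_simp

lemma gen_bound {s : ℕ → St} (hs : ∀ n, Inv n (s n) ∧ StepR n (s n) (s (n + 1)))
    {T : ℝ × ℝ → ℝ × ℝ} (hT : Continuous T)
    (hd : ∀ n z, dist (conj (s n).h (s n).a z) (T z) ≤ 2 * (1/2)^n)
    {f : Torus2 → ℝ} (hf : TF f) (n N : ℕ) (h1 : (n + 1) * (s n).q ≤ N)
    (h2 : N ≤ (n + 2) * (s (n + 1)).q) :
    |∑ j ∈ Finset.range N, f (torusProj (T^[j] (0, 0))) - N * ∫ z, f z|
      ≤ N * (6 * (1/2)^n + 2 * (1 / (n + 1))) := by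
  have i1 := (hs n).2.d N f hf
  have i2 : |∑ j ∈ Finset.range N, f (torusProj (T^[j] (0, 0))) -
      ∑ j ∈ Finset.range N, f (torusProj ((s (n + 1)).h.f (j * (s (n + 1)).a, 0)))|
      ≤ N * (1/2)^n := by
    rw [← Finset.sum_sub_distrib]
    refine (Finset.abs_sum_le_sum_abs _ _).trans ?_
    have : ∀ j ∈ Finset.range N, |f (torusProj (T^[j] (0, 0))) -
        f (torusProj ((s (n + 1)).h.f (j * (s (n + 1)).a, 0)))| ≤ (1/2)^n := by
      intro j hj
      have hjN := Finset.mem_range.1 hj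
      have o := orbit_close hs hT hd (n + 1) j (hjN.le.trans h2)
      have l := (hf.1.comp proj_lip).dist_le_mul (T^[j] (0, 0))
        ((s (n + 1)).h.f (j * (s (n + 1)).a, 0))
      rw [Real.dist_eq] at l
      simp only [Function.comp, mul_one, NNReal.coe_one, one_mul] at l
      refine l.trans ?_
      rw [dist_comm]
      refine o.trans (le_of_eq ?_)
      rw [pow_succ]; ring
    refine (Finset.sum_le_sum this).trans ?_
    simp
  have i3 : (2:ℝ) * (s n).q ≤ N * (2 * (1 / (n + 1))) := by
    have : ((n:ℝ) + 1) * (s n).q ≤ N := by exact_mod_cast h1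
    have hn : (0:ℝ) < n + 1 := by positivity
    have : ((s n).q : ℝ) ≤ N * (1 / (n + 1)) := by
      rw [mul_one_div, le_div_iff₀ hn]; linarith
    linarith
  have := abs_sub_le (∑ j ∈ Finset.range N, f (torusProj (T^[j] (0, 0))))
    (∑ j ∈ Finset.range N, f (torusProj ((s (n + 1)).h.f (j * (s (n + 1)).a, 0)))) (N * ∫ z, f z)
  linarith

lemma find_n {s : ℕ → St} (n0 N : ℕ) (h : (n0 + 1) * (s n0).q ≤ N) :
    ∃ n, n0 ≤ n ∧ (n + 1) * (s n).q ≤ N ∧ N ≤ (n + 2) * (s (n + 1)).q := by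
  by_contra hcon
  push Not at hcon
  have key : ∀ i, (n0 + i + 1) * (s (n0 + i)).q ≤ N := by
    intro i
    induction i with
    | zero => simpa using h
    | succ i ih => exact (hcon (n0 + i) (by omega) ih).le
  have h1 := key N
  have h2 := (s (n0 + N)).hq
  nlinarith

lemma gen_TF {s : ℕ → St} (hs : ∀ n, Inv n (s n) ∧ StepR n (s n) (s (n + 1)))
    {T : ℝ × ℝ → ℝ × ℝ} (hT : Continuous T)
    (hd : ∀ n z, dist (conj (s n).h (s n).a z) (T z) ≤ 2 * (1/2)^n)
    {f : Torus2 → ℝ} (hf : TF f) :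
    Tendsto (fun N : ℕ => (N : ℝ)⁻¹ * ∑ j ∈ Finset.range N, f (torusProj (T^[j] (0, 0)))) atTop
      (𝓝 (∫ z, f z)) := by
  have hlim : Tendsto (fun n : ℕ => 6 * (1/2 : ℝ)^n + 2 * (1 / ((n : ℝ) + 1))) atTop (𝓝 0) := by
    have a1 := (tendsto_pow_atTop_nhds_zero_of_lt_one (r := (1/2:ℝ)) (by norm_num)
      (by norm_num)).const_mul 6
    have a2 := (tendsto_one_div_add_atTop_nhds_zero_nat (𝕜 := ℝ)).const_mul 2
    simpa using a1.add a2
  rw [Metric.tendsto_atTop]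
  intro ε hε
  obtain ⟨n0, hn0⟩ := eventually_atTop.1 (hlim.eventually_lt_const hε)
  refine ⟨(n0 + 1) * (s n0).q, fun N hN => ?_⟩
  obtain ⟨n, hn, h1, h2⟩ := find_n n0 N hN
  have hb := gen_bound hs hT hd hf n N h1 h2
  have hN0 : 0 < N := lt_of_lt_of_le (Nat.mul_pos (Nat.succ_pos _) (s n0).hq) hN
  have hN' : (0:ℝ) < N := by exact_mod_cast hN0
  rw [Real.dist_eq]
  have e : (N : ℝ)⁻¹ * ∑ j ∈ Finset.range N, f (torusProj (T^[j] (0, 0))) - ∫ z, f z =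
      (N : ℝ)⁻¹ * (∑ j ∈ Finset.range N, f (torusProj (T^[j] (0, 0))) - N * ∫ z, f z) := by
    field_simp
  rw [e, abs_mul, abs_of_pos (by positivity), inv_mul_lt_iff₀ hN']
  refine hb.trans_lt ?_
  have := hn0 n hn
  gcongr

theorem generic {s : ℕ → St} (hs : ∀ n, Inv n (s n) ∧ StepR n (s n) (s (n + 1)))
    {T : ℝ × ℝ → ℝ × ℝ} (hT : Continuous T)
    (hd : ∀ n z, dist (conj (s n).h (s n).a z) (T z) ≤ 2 * (1/2)^n)
    (eT : IntEquivariant T) : IsGenericPt (desc T) volume (torusProj (0, 0)) := by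
  intro f
  have horb : ∀ j, (desc T)^[j] (torusProj (0, 0)) = torusProj (T^[j] (0, 0)) := by
    intro j
    induction j with
    | zero => rfl
    | succ j ih => rw [Function.iterate_succ_apply', Function.iterate_succ_apply', ih, desc_proj eT]
  simp only [horb]
  rw [Metric.tendsto_atTop]
  intro ε hε
  obtain ⟨g, A, hg, hfg⟩ := lip_dense f (ε := ε / 4) (by positivity)
  have hlim := (gen_TF hs hT hd hg).const_mul A
  obtain ⟨N0, hN0⟩ := Metric.tendsto_atTop.1 hlim (ε / 4) (by positivity)
  refine ⟨N0 + 1, fun N hN => ?_⟩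
  have h1 := hN0 N (by omega)
  have hN' : (0:ℝ) < N := by
    have : 0 < N := by omega
    exact_mod_cast this
  rw [Real.dist_eq] at h1 ⊢
  have h2 : |(N : ℝ)⁻¹ * ∑ j ∈ Finset.range N, f (torusProj (T^[j] (0, 0))) -
      A * ((N : ℝ)⁻¹ * ∑ j ∈ Finset.range N, g (torusProj (T^[j] (0, 0))))| ≤ ε / 4 := by
    rw [mul_left_comm, ← mul_sub, Finset.mul_sum, ← Finset.sum_sub_distrib, abs_mul,
      abs_of_pos (by positivity), inv_mul_le_iff₀ hN']
    refine (Finset.abs_sum_le_sum_abs _ _).trans ?_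
    refine (Finset.sum_le_sum fun j _ => hfg _).trans ?_
    simp
  have h3 : |(A * ∫ z, g z) - ∫ z, f z| ≤ ε / 4 := by
    rw [← integral_const_mul, ← integral_sub ((cont_integrable hg.1.continuous).const_mul A)
      (cont_integrable f.continuous)]
    have := norm_integral_le_of_norm_le_const (μ := (volume : Measure Torus2))
      (f := fun z => A * g z - f z) (C := ε / 4) (Eventually.of_forall fun z => by
        rw [Real.norm_eq_abs, abs_sub_comm]; exact hfg z)
    have hp := vol_prob
    simpa using this
  have t1 := abs_sub_le ((N : ℝ)⁻¹ * ∑ j ∈ Finset.range N, f (torusProj (T^[j] (0, 0))))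
    (A * ((N : ℝ)⁻¹ * ∑ j ∈ Finset.range N, g (torusProj (T^[j] (0, 0))))) (∫ z, f z)
  have t2 := abs_sub_le (A * ((N : ℝ)⁻¹ * ∑ j ∈ Finset.range N, g (torusProj (T^[j] (0, 0)))))
    (A * ∫ z, g z) (∫ z, f z)
  linarith

theorem nonergodic {s : ℕ → St} (hs : ∀ n, Inv n (s n) ∧ StepR n (s n) (s (n + 1)))
    {T : ℝ × ℝ → ℝ × ℝ}
    (hd : ∀ n z, dist (conj (s n).h (s n).a z) (T z) ≤ 2 * (1/2)^n)
    (hT : Continuous T) (eT : IntEquivariant T)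
    (hm : MeasurePreserving (desc T) (volume : Measure Torus2) volume) :
    ¬ IsErgodicWrt (desc T) volume := by
  intro herg
  have := vol_prob
  have hE : Ergodic (desc T) (volume : Measure Torus2) := by
    refine ⟨hm, ⟨fun E hE hinv => ?_⟩⟩
    rw [eventuallyConst_set']
    rcases herg E hE hinv with h | h
    · left
      exact ae_eq_empty.2 h
    · right
      exact ae_eq_univ.2 ((prob_compl_eq_zero_iff hE).2 h)
  let v : ℕ → Torus2 → ℝ := fun n z => chi (desc (s n).h.g z)
  have hv : ∀ n, Continuous (v n) := fun n => chi_cont.comp (s n).h.descg_cont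
  have hi : ∀ n, Integrable (v n) (volume : Measure Torus2) := fun n => cont_integrable (hv n)
  have hnorm : ∀ {a b : Torus2 → ℝ} (ha : Integrable a (volume : Measure Torus2))
      (hb : Integrable b (volume : Measure Torus2)),
      dist (ha.toL1 a) (hb.toL1 b) = ∫ z, |a z - b z| := by
    intro a b ha hb
    rw [dist_eq_norm, ← Integrable.toL1_sub, L1.norm_of_fun_eq_integral_norm]
    rfl
  let u : ℕ → Lp ℝ 1 (volume : Measure Torus2) := fun n => (hi n).toL1 (v n)
  have hu : ∀ n, dist (u n) (u (n + 1)) ≤ (1/50) / 2 / 2 ^ n := by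
    intro n
    rw [dist_comm, hnorm]
    refine ((hs n).2.a).trans (le_of_eq ?_)
    rw [one_div 2, inv_pow]
    ring
  obtain ⟨U, hU⟩ := cauchySeq_tendsto_of_complete (cauchySeq_of_le_geometric_two hu)
  have hU0 := dist_le_of_le_geometric_two_of_tendsto₀ hu hU
  let C : ℕ → C(Torus2, Torus2) := fun n =>
    ⟨desc (conj (s n).h (s n).a), desc_continuous (conj_equiv _ _) (conj_smooth _ _).continuous⟩
  let C0 : C(Torus2, Torus2) := ⟨desc T, desc_continuous eT hT⟩
  have hC : Tendsto C atTop (𝓝 C0) := by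
    rw [tendsto_iff_dist_tendsto_zero]
    refine squeeze_zero (fun _ => dist_nonneg) (fun n => ?_) half_tendsto
    rw [ContinuousMap.dist_le (by positivity)]
    intro z
    exact desc_dist (conj_equiv _ _) eT (hd n) z
  have hmC : ∀ n, MeasurePreserving (C n) (volume : Measure Torus2) volume := fun n => conj_mp _ _
  have hcomp := Filter.Tendsto.compMeasurePreservingLp hU hC hmC (g₀ := C0) hm (by simp)
  have hinv : ∀ n, Lp.compMeasurePreserving (C n) (hmC n) (u n) = u n := by
    intro n
    apply Lp.ext
    refine (Lp.coeFn_compMeasurePreserving _ (hmC n)).trans ?_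
    have h1 := (hi n).coeFn_toL1
    have h2 := (hmC n).quasiMeasurePreserving.ae_eq_comp h1
    refine h2.trans ?_
    have h3 : v n ∘ (C n) = v n := by
      funext z; exact chi_inv _ _ z
    rw [h3]
    exact h1.symm
  simp only [hinv] at hcomp
  have hUT := tendsto_nhds_unique hcomp hU
  have hUae : U ∘ desc T =ᵐ[volume] U := by
    have := Lp.coeFn_compMeasurePreserving U (f := C0) hm
    rw [hUT] at this
    exact this.symm
  obtain ⟨c, hc⟩ := hE.ae_eq_const_of_ae_eq_comp₀
    (Lp.aestronglyMeasurable U).aemeasurable.nullMeasurable hUae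
  have hUc : U = (integrable_const c).toL1 (fun _ : Torus2 => c) := by
    apply Lp.ext
    exact hc.trans (Integrable.coeFn_toL1 _).symm
  rw [hUc, hnorm] at hU0
  have h1 := mp_integral (s 0).h.inv_mp (F := fun z => |chi z - c|)
    (by have := chi_cont; fun_prop)
  have h2 := chi_nonconst c
  rw [← h1] at h2
  have : (1:ℝ)/16 ≤ 1/50 := h2.trans hU0
  norm_num at this

end AK

/-- There exists a smooth area-preserving diffeomorphism of `𝕋²` admitting the (non-ergodic)
Lebesgue measure as a generic measure: `μ` has a generic point for `T`, yet `T` is not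
ergodic with respect to `μ`. -/
theorem exists_smooth_nonergodic_generic_measure :
    ∃ T : SmoothMPTorusDiffeo,
      (∃ x : Torus2, IsGenericPt T.toEquiv volume x) ∧
      ¬ IsErgodicWrt T.toEquiv volume := by
  obtain ⟨s, hs⟩ := AK.seq_exists
  obtain ⟨T, cT, eT, dT⟩ := AK.lim_exists (F := fun n => AK.conj (s n).h (s n).a)
    (fun n => AK.conj_smooth _ _) (fun n => AK.conj_equiv _ _) (fun n => (hs n).2.b)
  obtain ⟨S, cS, eS, dS⟩ := AK.lim_exists (F := fun n => AK.conj (s n).h (-(s n).a))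
    (fun n => AK.conj_smooth _ _) (fun n => AK.conj_equiv _ _) (fun n => (hs n).2.b')
  have hTS : ∀ z, T (S z) = z := by
    intro z
    have := AK.lim_apply cT.continuous dT (AK.lim_self dS z)
    simp only [AK.conj_inv] at this
    exact tendsto_nhds_unique this tendsto_const_nhds
  have hST : ∀ z, S (T z) = z := by
    intro z
    have := AK.lim_apply cS.continuous dS (AK.lim_self dT z)
    have e : ∀ n, AK.conj (s n).h (-(s n).a) (AK.conj (s n).h (s n).a z) = z := by
      intro n
      have := AK.conj_inv (s n).h (-(s n).a) z
      rwa [neg_neg] at this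
    simp only [e] at this
    exact tendsto_nhds_unique this tendsto_const_nhds
  have hm := AK.lim_mp cT.continuous (fun n => (AK.conj_smooth _ _).continuous)
    (fun n => AK.conj_equiv _ _) eT dT (fun n => AK.conj_mp _ _)
  refine ⟨{ toEquiv := ⟨AK.desc T, AK.desc S, ?_, ?_⟩
            lift := T
            liftInv := S
            lift_contDiff := cT
            liftInv_contDiff := cS
            lift_equivariant := eT
            liftInv_equivariant := eS
            lift_isLift := AK.desc_proj eT
            liftInv_isLift := AK.desc_proj eS
            measurePreserving := hm }, ⟨torusProj (0, 0), ?_⟩, ?_⟩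
  · intro z
    obtain ⟨p, rfl⟩ := AK.proj_surj z
    rw [← AK.desc_proj eT, ← AK.desc_proj eS, hST]
  · intro z
    obtain ⟨p, rfl⟩ := AK.proj_surj z
    rw [← AK.desc_proj eS, ← AK.desc_proj eT, hTS]
  · exact AK.generic hs cT.continuous dT eT
  · exact AK.nonergodic hs dT cT.continuous eT hm
end
end

section
/- For every ε with 0 < ε < 1/4, there exists a C^∞ diffeomorphism φ of ℝ² preserving Lebesgue measure such that φ(x) = x for every x outside the square [ε, 1−ε]², and for every point (x, y) in the square [2ε, 1−2ε]² one has φ(x, y) = (y, 1−x), i.e., φ rotates the square [2ε, 1−2ε]² by π/2 in the clockwise direction about the center (1/2, 1/2). -/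
open MeasureTheory Filter Topology
noncomputable section

/-- Gauge functions on the plane: positively homogeneous, invariant under quarter turns. -/
structure IsGauge (N : ℝ × ℝ → ℝ) : Prop where
  cont : Continuous N
  hom : ∀ s x y : ℝ, 0 ≤ s → N (s * x, s * y) = s * N (x, y)
  pos : ∀ p, p ≠ 0 → 0 < N p
  rot : ∀ x y : ℝ, N (-y, x) = N (x, y)
  smooth : ContDiff ℝ (⊤ : ℕ∞) (fun t : ℝ => N (Real.cos t, Real.sin t))

lemma exists_gauge (a b : ℝ) (hb : 0 < b) (hab : b < a) :
    ∃ (N : ℝ × ℝ → ℝ) (c : ℝ), IsGauge N ∧ 0 < c ∧ c < a ∧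
      (∀ x y, |x| ≤ b → |y| ≤ b → N (x, y) ≤ c) ∧ (∀ x y, |x| ≤ N (x, y) ∧ |y| ≤ N (x, y)) := by
  have ha : 0 < a := hb.trans hab
  obtain ⟨k, hk⟩ := exists_pow_lt_of_lt_one (show (0:ℝ) < 1 / 2 by norm_num)
    (show b / a < 1 by rw [div_lt_one ha]; exact hab)
  set m : ℕ := 2 * (k + 1) with hm
  have hm0 : m ≠ 0 := by omega
  have hev : Even m := ⟨k + 1, by omega⟩
  have hba : 2 * b ^ m < a ^ m := by
    have h1 : (b / a) ^ m ≤ (b / a) ^ k :=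
      pow_le_pow_of_le_one (by positivity) (by rw [div_le_one ha]; exact hab.le) (by omega)
    have h2 : (b / a) ^ m < 1 / 2 := h1.trans_lt hk
    rw [div_pow, div_lt_iff₀ (by positivity)] at h2
    linarith
  have hinv : 0 < ((m : ℝ))⁻¹ := by positivity
  have hnn : ∀ x : ℝ, 0 ≤ x ^ m := fun x => hev.pow_nonneg x
  have hroot : ∀ x : ℝ, 0 ≤ x → (x ^ m) ^ ((m : ℝ)⁻¹) = x := fun x hx =>
    Real.pow_rpow_inv_natCast hx hm0
  have hposn : ∀ x y : ℝ, (x, y) ≠ ((0 : ℝ × ℝ)) → 0 < x ^ m + y ^ m := by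
    intro x y h
    by_cases hx : x = 0
    · have hy : y ≠ 0 := by
        rintro rfl; exact h (by rw [hx]; rfl)
      have := hev.pow_pos hy
      have := hnn x
      linarith
    · have := hev.pow_pos hx
      have := hnn y
      linarith
  refine ⟨fun p => (p.1 ^ m + p.2 ^ m) ^ ((m : ℝ)⁻¹), (2 * b ^ m) ^ ((m : ℝ)⁻¹),
    ⟨?_, ?_, ?_, ?_, ?_⟩, by positivity, ?_, ?_, ?_⟩
  · exact Continuous.rpow_const (by fun_prop) (fun _ => Or.inr hinv.le)
  · intro s x y hs
    simp only [mul_pow, ← mul_add]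
    rw [Real.mul_rpow (by positivity) (add_nonneg (hnn _) (hnn _)), hroot s hs]
  · rintro ⟨x, y⟩ h
    exact Real.rpow_pos_of_pos (hposn x y h) _
  · intro x y
    simp only [hev.neg_pow, add_comm]
  · apply ContDiff.rpow_const_of_ne
    · fun_prop
    · intro t
      apply ne_of_gt
      apply hposn
      intro h
      have h1 := congrArg Prod.fst h
      have h2 := congrArg Prod.snd h
      simp only [Prod.fst_zero, Prod.snd_zero] at h1 h2
      have := Real.sin_sq_add_cos_sq t
      rw [h1, h2] at this
      norm_num at this
  · calc (2 * b ^ m) ^ ((m : ℝ)⁻¹) < (a ^ m) ^ ((m : ℝ)⁻¹) :=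
          Real.rpow_lt_rpow (by positivity) hba hinv
      _ = a := hroot a ha.le
  · intro x y hx hy
    apply Real.rpow_le_rpow (add_nonneg (hnn _) (hnn _)) _ hinv.le
    have h1 : x ^ m ≤ b ^ m := by
      rw [← hev.pow_abs]; exact pow_le_pow_left₀ (abs_nonneg _) hx _
    have h2 : y ^ m ≤ b ^ m := by
      rw [← hev.pow_abs]; exact pow_le_pow_left₀ (abs_nonneg _) hy _
    simp only
    linarith
  · intro x y
    constructor
    · rw [← hroot |x| (abs_nonneg x), hev.pow_abs]
      exact Real.rpow_le_rpow (hnn _) (by have := hnn y; simp only; linarith) hinv.le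
    · rw [← hroot |y| (abs_nonneg y), hev.pow_abs]
      exact Real.rpow_le_rpow (hnn _) (by have := hnn x; simp only; linarith) hinv.le

/-- A parametrization of the unit curve of the gauge with unit areal speed. -/
structure IsCurve (N : ℝ × ℝ → ℝ) (x y : ℝ → ℝ) (A : ℝ) : Prop where
  sx : ContDiff ℝ (⊤ : ℕ∞) x
  sy : ContDiff ℝ (⊤ : ℕ∞) y
  area : ∀ t, x t * deriv y t - y t * deriv x t = 1
  rotx : ∀ t, x (t + A) = - y t
  roty : ∀ t, y (t + A) = x t
  unit : ∀ t, N (x t, y t) = 1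
  surj : ∀ p : ℝ × ℝ, p ≠ 0 → ∃ t, (N p * x t, N p * y t) = p
  inj : ∀ t t', x t = x t' → y t = y t' → ∀ a, x (t + a) = x (t' + a) ∧ y (t + a) = y (t' + a)

lemma exists_curve (N : ℝ × ℝ → ℝ) (hN : IsGauge N) : ∃ x y A, IsCurve N x y A := by
  set g : ℝ → ℝ := fun t => N (Real.cos t, Real.sin t) with hg
  have gpos : ∀ t, 0 < g t := by
    intro t
    apply hN.pos
    intro h
    have h1 := congrArg Prod.fst h
    have h2 := congrArg Prod.snd h
    simp only [Prod.fst_zero, Prod.snd_zero] at h1 h2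
    have := Real.sin_sq_add_cos_sq t
    rw [h1, h2] at this
    norm_num at this
  set ρ : ℝ → ℝ := fun t => (g t)⁻¹ with hρ
  have ρpos : ∀ t, 0 < ρ t := fun t => inv_pos.2 (gpos t)
  have ρs : ContDiff ℝ (⊤ : ℕ∞) ρ := hN.smooth.inv (fun t => (gpos t).ne')
  have ρper : Function.Periodic ρ (Real.pi / 2) := by
    intro t
    simp only [hρ, hg, Real.cos_add_pi_div_two, Real.sin_add_pi_div_two, hN.rot]
  have ρ2s : ContDiff ℝ (⊤ : ℕ∞) (fun t => ρ t ^ 2) := ρs.pow 2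
  have ρ2per : Function.Periodic (fun t => ρ t ^ 2) (Real.pi / 2) := by
    intro t
    simp only [ρper t]
  set Θ : ℝ → ℝ := fun u => ∫ t in (0:ℝ)..u, ρ t ^ 2 with hΘ
  have Θd : ∀ u, HasDerivAt Θ (ρ u ^ 2) u := fun u =>
    intervalIntegral.integral_hasDerivAt_right (ρ2s.continuous.intervalIntegrable _ _)
      (ρ2s.continuous.stronglyMeasurableAtFilter _ _) ρ2s.continuous.continuousAt
  have Θs : ContDiff ℝ (⊤ : ℕ∞) Θ := by
    rw [contDiff_infty_iff_deriv]
    refine ⟨fun u => (Θd u).differentiableAt, ?_⟩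
    have : deriv Θ = fun t => ρ t ^ 2 := funext fun u => (Θd u).deriv
    rw [this]; exact ρ2s
  have Θmono : StrictMono Θ := strictMono_of_deriv_pos (fun u => by
    rw [(Θd u).deriv]; exact pow_pos (ρpos u) 2)
  have Θ0 : Θ 0 = 0 := by simp [hΘ]
  set A := Θ (Real.pi / 2) with hA
  have Apos : 0 < A := by
    rw [← Θ0]; exact Θmono (by positivity)
  have Θper : ∀ u, Θ (u + Real.pi / 2) = Θ u + A := by
    intro u
    have h1 := ρ2per.intervalIntegral_add_eq u 0
    have h2 := intervalIntegral.integral_add_adjacent_intervals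
      (ρ2s.continuous.intervalIntegrable (μ := volume) 0 u)
      (ρ2s.continuous.intervalIntegrable (μ := volume) u (u + Real.pi / 2))
    simp only [hΘ, hA]
    rw [← h2, h1, zero_add]
  have hG : Function.Periodic (fun u => Θ u - (A / (Real.pi / 2)) * u) (Real.pi / 2) := by
    intro u
    simp only [Θper]
    have := Real.pi_pos
    field_simp
    ring
  have Θint : ∀ (k : ℤ) u, Θ (u + k * (Real.pi / 2)) = Θ u + k * A := by
    intro k u
    have h := hG.int_mul k u
    have h3 : (A / (Real.pi / 2)) * (u + k * (Real.pi / 2))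
        = (A / (Real.pi / 2)) * u + k * A := by
      have := Real.pi_pos
      field_simp
    linarith
  have Θsurj : Function.Surjective Θ := by
    intro v
    have key : ∀ k : ℤ, Θ (k * (Real.pi / 2)) = k * A := by
      intro k
      have := Θint k 0
      simpa [Θ0] using this
    apply mem_range_of_exists_le_of_exists_ge Θs.continuous
    · refine ⟨_, (key ⌊v / A⌋).trans_le ?_⟩
      rw [← le_div_iff₀ Apos]; exact Int.floor_le _
    · refine ⟨_, le_of_le_of_eq ?_ (key ⌈v / A⌉).symm⟩
      rw [← div_le_iff₀ Apos]; exact Int.le_ceil _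
  set e := (Θmono.orderIsoOfSurjective Θ Θsurj).toHomeomorph with he
  have eΘ : ∀ u, e u = Θ u := fun u => rfl
  set θ : ℝ → ℝ := fun t => e.symm t with hθ
  have θΘ : ∀ u, θ (Θ u) = u := fun u => by rw [← eΘ]; exact e.symm_apply_apply u
  have Θθ : ∀ t, Θ (θ t) = t := fun t => by rw [← eΘ]; exact e.apply_symm_apply t
  have θs : ContDiff ℝ (⊤ : ℕ∞) θ :=
    Homeomorph.contDiff_symm_deriv (f := e) (f' := fun u => ρ u ^ 2)
      (fun u => (pow_pos (ρpos u) 2).ne') Θd Θs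
  have θd : ∀ t, HasDerivAt θ ((ρ (θ t) ^ 2)⁻¹) t := fun t =>
    HasDerivAt.of_local_left_inverse (f := Θ) θs.continuous.continuousAt (Θd _)
      (pow_pos (ρpos _) 2).ne' (Eventually.of_forall Θθ)
  have θA : ∀ t, θ (t + A) = θ t + Real.pi / 2 := by
    intro t
    apply Θmono.injective
    rw [Θθ, Θper, Θθ]
  set x : ℝ → ℝ := fun t => ρ (θ t) * Real.cos (θ t) with hx
  set y : ℝ → ℝ := fun t => ρ (θ t) * Real.sin (θ t) with hy
  have rotx : ∀ t, x (t + A) = - y t := by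
    intro t
    simp only [hx, hy, θA, ρper (θ t), Real.cos_add_pi_div_two]; ring
  have roty : ∀ t, y (t + A) = x t := by
    intro t
    simp only [hx, hy, θA, ρper (θ t), Real.sin_add_pi_div_two]
  have perx : Function.Periodic x (4 * A) := by
    intro t
    rw [show t + 4 * A = t + A + A + A + A by ring]
    simp [rotx, roty]
  have pery : Function.Periodic y (4 * A) := by
    intro t
    rw [show t + 4 * A = t + A + A + A + A by ring]
    simp [rotx, roty]
  refine ⟨x, y, A, ?_, ?_, ?_, rotx, roty, ?_, ?_, ?_⟩
  · exact (ρs.comp θs).mul (Real.contDiff_cos.comp θs)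
  · exact (ρs.comp θs).mul (Real.contDiff_sin.comp θs)
  · intro t
    have hρd : HasDerivAt ρ (deriv ρ (θ t)) (θ t) :=
      (ρs.differentiable (by simp) (θ t)).hasDerivAt
    have h1 := (hρd.comp t (θd t)).mul ((Real.hasDerivAt_cos (θ t)).comp t (θd t))
    have h2 := (hρd.comp t (θd t)).mul ((Real.hasDerivAt_sin (θ t)).comp t (θd t))
    have e1 : deriv x t = _ := h1.deriv
    have e2 : deriv y t = _ := h2.deriv
    rw [e1, e2]
    simp only [hx, hy, Function.comp]
    have hp := (ρpos (θ t)).ne'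
    have hcs := Real.sin_sq_add_cos_sq (θ t)
    generalize ρ (θ t) = r at hp ⊢
    generalize deriv ρ (θ t) = d
    field_simp
    linear_combination r * hcs
  · intro t
    simp only [hx, hy]
    rw [hN.hom _ _ _ (ρpos _).le]
    exact inv_mul_cancel₀ (gpos (θ t)).ne'
  · rintro ⟨p, q⟩ hpq
    set z : ℂ := ⟨p, q⟩ with hz
    have hc : ‖z‖ * Real.cos z.arg = p := Complex.norm_mul_cos_arg z
    have hs : ‖z‖ * Real.sin z.arg = q := Complex.norm_mul_sin_arg z
    refine ⟨Θ z.arg, ?_⟩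
    have hNp : N (p, q) = ‖z‖ * g z.arg := by
      rw [← hN.hom _ _ _ (norm_nonneg z), hc, hs]
    have hgp := (gpos z.arg).ne'
    simp only [hx, hy, θΘ, hNp, hρ]
    ext
    · simp only; rw [← hc]; field_simp
    · simp only; rw [← hs]; field_simp
  · intro t t' h1 h2 a
    simp only [hx, hy] at h1 h2
    have hρe : ρ (θ t) = ρ (θ t') := by
      have c1 := Real.sin_sq_add_cos_sq (θ t)
      have c2 := Real.sin_sq_add_cos_sq (θ t')
      have : ρ (θ t) ^ 2 = ρ (θ t') ^ 2 := by
        calc ρ (θ t) ^ 2 = (ρ (θ t) * Real.cos (θ t)) ^ 2 + (ρ (θ t) * Real.sin (θ t)) ^ 2 := by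
              linear_combination (-ρ (θ t) ^ 2) * c1
          _ = (ρ (θ t') * Real.cos (θ t')) ^ 2 + (ρ (θ t') * Real.sin (θ t')) ^ 2 := by
              rw [h1, h2]
          _ = _ := by linear_combination (ρ (θ t') ^ 2) * c2
      exact (pow_left_inj₀ (ρpos _).le (ρpos _).le (by norm_num)).1 this
    rw [hρe] at h1 h2
    have hcos := mul_left_cancel₀ (ρpos (θ t')).ne' h1
    have hsin := mul_left_cancel₀ (ρpos (θ t')).ne' h2
    obtain ⟨k, hk⟩ := Real.Angle.angle_eq_iff_two_pi_dvd_sub.1 (Real.Angle.cos_sin_inj hcos hsin)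
    have ht : t = t' + k * (4 * A) := by
      have := Θint (4 * k) (θ t')
      rw [show θ t' + ((4 * k : ℤ) : ℝ) * (Real.pi / 2) = θ t by push_cast; linarith, Θθ, Θθ] at this
      push_cast at this
      linarith
    have e1 : t + a = (t' + a) + k * (4 * A) := by rw [ht]; ring
    rw [e1]
    exact ⟨perx.int_mul k _, pery.int_mul k _⟩

def Qmap (x y τ : ℝ → ℝ) (q : ℝ × ℝ) : ℝ × ℝ :=
  (q.1 * x (q.2 - τ q.1), q.1 * y (q.2 - τ q.1))

lemma Qmap_contDiff {x y τ : ℝ → ℝ} (hx : ContDiff ℝ (⊤ : ℕ∞) x) (hy : ContDiff ℝ (⊤ : ℕ∞) y)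
    (hτ : ContDiff ℝ (⊤ : ℕ∞) τ) : ContDiff ℝ (⊤ : ℕ∞) (Qmap x y τ) := by
  unfold Qmap
  have h1 : ContDiff ℝ (⊤ : ℕ∞) (fun q : ℝ × ℝ => q.2 - τ q.1) :=
    contDiff_snd.sub (hτ.comp contDiff_fst)
  exact (contDiff_fst.mul (hx.comp h1)).prodMk (contDiff_fst.mul (hy.comp h1))

lemma Qmap_deriv {x y τ : ℝ → ℝ} (hx : ContDiff ℝ (⊤ : ℕ∞) x) (hy : ContDiff ℝ (⊤ : ℕ∞) y)
    (hτ : ContDiff ℝ (⊤ : ℕ∞) τ) (har : ∀ t, x t * deriv y t - y t * deriv x t = 1)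
    (q : ℝ × ℝ) : ∃ D : ℝ × ℝ →L[ℝ] ℝ × ℝ, HasFDerivAt (Qmap x y τ) D q ∧ D.det = q.1 := by
  have htop : ((⊤ : ℕ∞) : WithTop ℕ∞) ≠ 0 := by simp
  set u := q.2 - τ q.1 with hu
  refine ⟨(Matrix.toLin (.finTwoProd ℝ) (.finTwoProd ℝ)
    !![x u - q.1 * deriv τ q.1 * deriv x u, q.1 * deriv x u;
       y u - q.1 * deriv τ q.1 * deriv y u, q.1 * deriv y u]).toContinuousLinearMap, ?_, ?_⟩
  · rw [Matrix.toLin_finTwoProd_toContinuousLinearMap]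
    have dx : HasDerivAt x (deriv x u) u := (hx.differentiable htop u).hasDerivAt
    have dy : HasDerivAt y (deriv y u) u := (hy.differentiable htop u).hasDerivAt
    have dτ : HasDerivAt τ (deriv τ q.1) q.1 := (hτ.differentiable htop q.1).hasDerivAt
    have d0 : HasFDerivAt (fun q : ℝ × ℝ => τ q.1)
        (deriv τ q.1 • ContinuousLinearMap.fst ℝ ℝ ℝ) q :=
      dτ.comp_hasFDerivAt q hasFDerivAt_fst
    have d1 : HasFDerivAt (fun q : ℝ × ℝ => q.2 - τ q.1)
        (ContinuousLinearMap.snd ℝ ℝ ℝ - deriv τ q.1 • ContinuousLinearMap.fst ℝ ℝ ℝ) q :=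
      hasFDerivAt_snd.sub d0
    have hfin := HasFDerivAt.prodMk (𝕜 := ℝ)
      (hasFDerivAt_fst.mul (dx.comp_hasFDerivAt q d1))
      (hasFDerivAt_fst.mul (dy.comp_hasFDerivAt q d1))
    refine hfin.congr_fderiv ?_
    ext <;> simp [← hu] <;> ring
  · rw [ContinuousLinearMap.det]
    simp only [LinearMap.coe_toContinuousLinearMap, LinearMap.det_toLin, Matrix.det_fin_two_of]
    linear_combination q.1 * har u

/-- The twist map in the plane associated to a shear by `τ`. -/
def twist (N : ℝ × ℝ → ℝ) (x y : ℝ → ℝ) (T : ℝ × ℝ → ℝ) (τ : ℝ → ℝ) (p : ℝ × ℝ) : ℝ × ℝ :=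
  (N p * x (T p - τ (N p)), N p * y (T p - τ (N p)))

section
variable {N : ℝ × ℝ → ℝ} {x y : ℝ → ℝ} {A : ℝ} {T : ℝ × ℝ → ℝ} {τ : ℝ → ℝ}

lemma twist_param (hN : IsGauge N) (hc : IsCurve N x y A)
    (hT : ∀ p : ℝ × ℝ, p ≠ 0 → (N p * x (T p), N p * y (T p)) = p) (τ : ℝ → ℝ) (q : ℝ × ℝ)
    (hq : 0 < q.1) : twist N x y T τ (Qmap x y (fun _ => 0) q) = Qmap x y τ q := by
  obtain ⟨s, t⟩ := q
  simp only [Qmap, sub_zero, twist] at *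
  have hNs : N (s * x t, s * y t) = s := by rw [hN.hom _ _ _ hq.le, hc.unit, mul_one]
  have hne : (s * x t, s * y t) ≠ (0 : ℝ × ℝ) := by
    intro h
    have h0 : N (0, 0) = 0 := by simpa using hN.hom 0 0 0 le_rfl
    rw [h] at hNs
    exact hq.ne' (hNs.symm.trans h0)
  have h := hT _ hne
  rw [hNs] at h ⊢
  have h1 := mul_left_cancel₀ hq.ne' (congrArg Prod.fst h)
  have h2 := mul_left_cancel₀ hq.ne' (congrArg Prod.snd h)
  obtain ⟨h3, h4⟩ := hc.inj _ _ h1 h2 (- τ s)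
  simp only [sub_eq_add_neg, h3, h4]

lemma twist_zero (hN : IsGauge N) : twist N x y T τ 0 = 0 := by
  have h0 : N (0, 0) = 0 := by simpa using hN.hom 0 0 0 le_rfl
  show (N (0, 0) * _, N (0, 0) * _) = ((0 : ℝ), (0 : ℝ))
  rw [h0, zero_mul, zero_mul]

lemma twist_inv (hN : IsGauge N) (hc : IsCurve N x y A)
    (hT : ∀ p : ℝ × ℝ, p ≠ 0 → (N p * x (T p), N p * y (T p)) = p) (τ σ : ℝ → ℝ)
    (hτσ : ∀ s, τ s + σ s = 0) (p : ℝ × ℝ) :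
    twist N x y T τ (twist N x y T σ p) = p := by
  by_cases hp : p = 0
  · rw [hp, twist_zero hN, twist_zero hN]
  · have hs := hN.pos p hp
    have h1 : twist N x y T σ p = Qmap x y (fun _ => 0) (N p, T p - σ (N p)) := by
      simp [twist, Qmap]
    rw [h1, twist_param hN hc hT τ _ hs]
    have h2 : T p - σ (N p) - τ (N p) = T p := by have := hτσ (N p); linarith
    simp only [Qmap, h2]
    exact hT p hp

/-- Smoothness of the twist and its Jacobian away from the origin. -/
lemma twist_away (hN : IsGauge N) (hc : IsCurve N x y A)
    (hT : ∀ p : ℝ × ℝ, p ≠ 0 → (N p * x (T p), N p * y (T p)) = p)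
    (hτ : ContDiff ℝ (⊤ : ℕ∞) τ) (p : ℝ × ℝ) (hp : p ≠ 0) :
    ContDiffAt ℝ (⊤ : ℕ∞) (twist N x y T τ) p ∧ (fderiv ℝ (twist N x y T τ) p).det = 1 := by
  have htop : ((⊤ : ℕ∞) : WithTop ℕ∞) ≠ 0 := by simp
  set P := Qmap x y (fun _ => 0) with hP
  set q : ℝ × ℝ := (N p, T p) with hq
  have hqpos : 0 < q.1 := hN.pos p hp
  have hPq : P q = p := by
    simp only [hP, Qmap, hq, sub_zero]; exact hT p hp
  have hPs : ContDiff ℝ (⊤ : ℕ∞) P := Qmap_contDiff hc.sx hc.sy contDiff_const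
  have hQs : ContDiff ℝ (⊤ : ℕ∞) (Qmap x y τ) := Qmap_contDiff hc.sx hc.sy hτ
  obtain ⟨D, hD, hDdet⟩ := Qmap_deriv hc.sx hc.sy (τ := fun _ => 0) contDiff_const hc.area q
  obtain ⟨E, hE, hEdet⟩ := Qmap_deriv hc.sx hc.sy hτ hc.area q
  have hdet : D.det ≠ 0 := by rw [hDdet]; exact hqpos.ne'
  have hD' : HasFDerivAt P (D.toContinuousLinearEquivOfDetNeZero hdet : ℝ × ℝ →L[ℝ] ℝ × ℝ) q := by
    rw [ContinuousLinearMap.coe_toContinuousLinearEquivOfDetNeZero]; exact hD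
  have hPa := hPs.contDiffAt (x := q)
  have hstrict := hPa.hasStrictFDerivAt' hD' htop
  have hinv := hPa.to_localInverse hD' htop
  have hright : ∀ᶠ z in 𝓝 (P q), P (hPa.localInverse hD' htop z) = z :=
    hstrict.eventually_right_inverse
  have hval := hPa.localInverse_apply_image hD' htop
  have hpos : ∀ᶠ z in 𝓝 (P q), 0 < (hPa.localInverse hD' htop z).1 := by
    have hcont : ContinuousAt (fun z => (hPa.localInverse hD' htop z).1) (P q) :=
      continuousAt_fst.comp hinv.continuousAt
    apply hcont.eventually_const_lt
    show 0 < (hPa.localInverse hD' htop (P q)).1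
    rw [hval]; exact hqpos
  have heq : twist N x y T τ =ᶠ[𝓝 (P q)] fun z => Qmap x y τ (hPa.localInverse hD' htop z) := by
    filter_upwards [hright, hpos] with z h1 h2
    rw [← twist_param hN hc hT τ _ h2]
    congr 1
    exact h1.symm
  have hsm : ContDiffAt ℝ (⊤ : ℕ∞) (twist N x y T τ) p := by
    rw [← hPq]
    refine ContDiffAt.congr_of_eventuallyEq ?_ heq
    exact hQs.contDiffAt.comp (P q) hinv
  refine ⟨hsm, ?_⟩
  have hf : HasFDerivAt (twist N x y T τ) (fderiv ℝ (twist N x y T τ) p) (P q) := by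
    rw [hPq]; exact (hsm.differentiableAt htop).hasFDerivAt
  have hcomp := hf.comp q hD
  have hcomp' : HasFDerivAt (Qmap x y τ) ((fderiv ℝ (twist N x y T τ) p).comp D) q := by
    refine hcomp.congr_of_eventuallyEq ?_
    have : ∀ᶠ r : ℝ × ℝ in 𝓝 q, 0 < r.1 := continuousAt_fst.eventually_const_lt hqpos
    filter_upwards [this] with r hr
    exact (twist_param hN hc hT τ r hr).symm
  have hEeq := hE.unique hcomp'
  have hmul : E.det = (fderiv ℝ (twist N x y T τ) p).det * D.det := by
    rw [hEeq]
    simp only [ContinuousLinearMap.det, ContinuousLinearMap.toLinearMap_comp]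
    exact LinearMap.det_comp _ _
  rw [hEdet, hDdet] at hmul
  exact (mul_right_cancel₀ hqpos.ne' (by rw [one_mul]; exact hmul)).symm

/-- The twist is smooth if it is linear near the origin. -/
lemma twist_contDiff (hN : IsGauge N) (hc : IsCurve N x y A)
    (hT : ∀ p : ℝ × ℝ, p ≠ 0 → (N p * x (T p), N p * y (T p)) = p)
    (hτ : ContDiff ℝ (⊤ : ℕ∞) τ) (L : ℝ × ℝ → ℝ × ℝ) (hL : ContDiff ℝ (⊤ : ℕ∞) L)
    (c : ℝ) (hc0 : 0 < c) (hLt : ∀ p, N p ≤ c → twist N x y T τ p = L p) :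
    ContDiff ℝ (⊤ : ℕ∞) (twist N x y T τ) := by
  rw [contDiff_iff_contDiffAt]
  intro p
  by_cases hp : p = 0
  · refine hL.contDiffAt.congr_of_eventuallyEq ?_
    have h0 : N (0, 0) = 0 := by simpa using hN.hom 0 0 0 le_rfl
    have : ∀ᶠ z in 𝓝 p, N z < c :=
      hN.cont.continuousAt.eventually_lt_const (by rw [hp]; exact h0.trans_lt hc0)
    filter_upwards [this] with z hz
    exact hLt z hz.le
  · exact (twist_away hN hc hT hτ p hp).1

end

lemma measurePreserving_of_det (φ : (ℝ × ℝ) ≃ (ℝ × ℝ)) (h1 : ContDiff ℝ (⊤ : ℕ∞) φ)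
    (hdet : ∀ p, p ≠ 0 → (fderiv ℝ φ p).det = 1) : MeasurePreserving φ volume volume := by
  have htop : ((⊤ : ℕ∞) : WithTop ℕ∞) ≠ 0 := by simp
  refine ⟨h1.continuous.measurable, ?_⟩
  ext s hs
  rw [Measure.map_apply h1.continuous.measurable hs]
  have hm : MeasurableSet (φ ⁻¹' s) := h1.continuous.measurable hs
  have key := lintegral_abs_det_fderiv_eq_addHaar_image (volume : Measure (ℝ × ℝ)) hm
    (fun p _ => ((h1.differentiable htop p).hasFDerivAt).hasFDerivWithinAt) φ.injective.injOn
  rw [Set.image_preimage_eq _ φ.surjective] at key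
  rw [← key]
  have hae : ∀ᵐ p ∂(volume.restrict (φ ⁻¹' s)), ENNReal.ofReal |(fderiv ℝ φ p).det| = 1 := by
    have : ∀ᵐ p : ℝ × ℝ ∂volume, p ≠ 0 := Measure.ae_ne volume 0
    filter_upwards [ae_restrict_of_ae this] with p hp
    rw [hdet p hp]; simp
  rw [lintegral_congr_ae hae]
  simp

theorem exists_smooth_partial_rotation (ε : ℝ) (hε0 : 0 < ε) (hε : ε < 1 / 4) :
    ∃ φ : (ℝ × ℝ) ≃ (ℝ × ℝ),
      ContDiff ℝ (⊤ : ℕ∞) φ ∧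
      ContDiff ℝ (⊤ : ℕ∞) φ.symm ∧
      MeasurePreserving φ volume volume ∧
      (∀ p : ℝ × ℝ, p ∉ Set.Icc ((ε, ε) : ℝ × ℝ) ((1 - ε, 1 - ε) : ℝ × ℝ) → φ p = p) ∧
      (∀ p : ℝ × ℝ, p ∈ Set.Icc ((2 * ε, 2 * ε) : ℝ × ℝ) ((1 - 2 * ε, 1 - 2 * ε) : ℝ × ℝ) →
        φ p = (p.2, 1 - p.1)) := by
  obtain ⟨N, c, hN, hc0, hca, hin, hout⟩ :=
    exists_gauge (1 / 2 - ε) (1 / 2 - 2 * ε) (by linarith) (by linarith)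
  obtain ⟨x, y, A, hc⟩ := exists_curve N hN
  have hex : ∀ p : ℝ × ℝ, ∃ t, p ≠ 0 → (N p * x t, N p * y t) = p := by
    intro p
    by_cases hp : p = 0
    · exact ⟨0, fun h => absurd hp h⟩
    · obtain ⟨t, ht⟩ := hc.surj p hp
      exact ⟨t, fun _ => ht⟩
  choose T hT using hex
  set a : ℝ := 1 / 2 - ε with ha
  set τ : ℝ → ℝ := fun s => A * Real.smoothTransition ((a - s) / (a - c)) with hτ
  have hτs : ContDiff ℝ (⊤ : ℕ∞) τ :=
    contDiff_const.mul (Real.smoothTransition.contDiff.comp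
      ((contDiff_const.sub contDiff_id).div_const _))
  have hac : 0 < a - c := by linarith
  have hτ1 : ∀ s, s ≤ c → τ s = A := by
    intro s hs
    simp only [hτ]
    rw [Real.smoothTransition.one_of_one_le, mul_one]
    rw [le_div_iff₀ hac]; linarith
  have hτ0 : ∀ s, a ≤ s → τ s = 0 := by
    intro s hs
    simp only [hτ]
    rw [Real.smoothTransition.zero_of_nonpos, mul_zero]
    exact div_nonpos_of_nonpos_of_nonneg (by linarith) hac.le
  set F := twist N x y T τ with hF
  set G := twist N x y T (fun s => - τ s) with hG
  have hFG : ∀ p, F (G p) = p := twist_inv hN hc hT _ _ (fun s => by ring)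
  have hGF : ∀ p, G (F p) = p := twist_inv hN hc hT _ _ (fun s => by ring)
  have hF1 : ∀ p, N p ≤ c → F p = (p.2, - p.1) := by
    intro p hp
    by_cases h0 : p = 0
    · rw [h0, hF, twist_zero hN]; ext <;> simp
    · have h := hT p h0
      have e1 := hc.rotx (T p - A)
      have e2 := hc.roty (T p - A)
      rw [sub_add_cancel] at e1 e2
      have h1 := congrArg Prod.fst h
      have h2 := congrArg Prod.snd h
      simp only at h1 h2
      simp only [hF, twist, hτ1 _ hp]
      ext
      · simp only; rw [← h2, ← e2]
      · simp only; rw [← h1, e1]; ring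
  have hG1 : ∀ p, N p ≤ c → G p = (- p.2, p.1) := by
    intro p hp
    by_cases h0 : p = 0
    · rw [h0, hG, twist_zero hN]; ext <;> simp
    · have h := hT p h0
      have h1 := congrArg Prod.fst h
      have h2 := congrArg Prod.snd h
      simp only at h1 h2
      simp only [hG, twist, hτ1 _ hp, sub_neg_eq_add, hc.rotx, hc.roty]
      ext
      · simp only; linarith
      · simp only; linarith
  have hFs : ContDiff ℝ (⊤ : ℕ∞) F :=
    twist_contDiff hN hc hT hτs (fun p => (p.2, - p.1)) (by fun_prop) c hc0 hF1
  have hGs : ContDiff ℝ (⊤ : ℕ∞) G :=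
    twist_contDiff hN hc hT hτs.neg (fun p => (- p.2, p.1)) (by fun_prop) c hc0 hG1
  have hFid : ∀ p, a ≤ N p → F p = p := by
    intro p hp
    by_cases h0 : p = 0
    · rw [h0, hF, twist_zero hN]
    · simp only [hF, twist, hτ0 _ hp, sub_zero]
      exact hT p h0
  let Φ : (ℝ × ℝ) ≃ (ℝ × ℝ) := ⟨F, G, hGF, hFG⟩
  have hΦ : MeasurePreserving Φ volume volume :=
    measurePreserving_of_det Φ hFs (fun p hp => (twist_away hN hc hT hτs p hp).2)
  set o : ℝ × ℝ := (1 / 2, 1 / 2) with ho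
  refine ⟨((Equiv.subRight o).trans Φ).trans (Equiv.addRight o), ?_, ?_, ?_, ?_, ?_⟩
  · show ContDiff ℝ (⊤ : ℕ∞) (fun p => F (p - o) + o)
    exact (hFs.comp (contDiff_id.sub contDiff_const)).add contDiff_const
  · have : ⇑(((Equiv.subRight o).trans Φ).trans (Equiv.addRight o)).symm
        = fun p => G (p - o) + o := by
      funext p
      simp [Φ, sub_eq_add_neg]
    rw [this]
    exact (hGs.comp (contDiff_id.sub contDiff_const)).add contDiff_const
  · exact (measurePreserving_add_right volume o).comp
      (hΦ.comp (measurePreserving_sub_right volume o))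
  · intro p hp
    show F (p - o) + o = p
    rw [hFid, sub_add_cancel]
    by_contra hlt
    push Not at hlt
    apply hp
    obtain ⟨b1, b2⟩ := hout (p - o).1 (p - o).2
    have b3 := abs_le.1 (b1.trans hlt.le)
    have b4 := abs_le.1 (b2.trans hlt.le)
    simp only [Prod.fst_sub, Prod.snd_sub, ho, ha] at b3 b4
    exact ⟨⟨by simp only; linarith, by simp only; linarith⟩,
      ⟨by simp only; linarith, by simp only; linarith⟩⟩
  · rintro p ⟨⟨p1, p2⟩, ⟨p3, p4⟩⟩
    simp only at p1 p2 p3 p4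
    show F (p - o) + o = _
    rw [hF1 (p - o) (hin _ _ ?_ ?_)]
    · ext
      · simp [ho]
      · simp only [ho, Prod.fst_sub, Prod.snd_add]; ring
    · rw [abs_le]; simp only [ho]; constructor <;> linarith
    · rw [abs_le]; simp only [ho]; constructor <;> linarith
end
end
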